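/- For every β > 1 and every vertex z on the main part of a branch of order 1 of the fractal configuration ξ, the β-biased random walk Z_t = (X_t,Y_t) started at z on ξ satisfies lim_{t→∞} X_t/t = (β−1)/(β+1) almost surely. -/

import Mathlib

open MeasureTheory Filter
open scoped ENNReal

noncomputable section

/-- Vertices of the square lattice. -/
abbrev V : Type := ℤ × ℤ

/-- Adjacency in the square lattice ℤ²: Euclidean distance one. -/
def latAdj (u v : V) : Prop := (u.1 - v.1) ^ 2 + (u.2 - v.2) ^ 2 = 1

instance : MeasurableSpace (Sym2 V) := ⊤

open scoped Classical in
/-- One-step transition probability of the β-biased random walk on the subgraph of ℤ²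
with edge set `G`: if the set `Λ` of neighbours of `z` is nonempty and contains the right
neighbour `(z.1+1, z.2)`, step to it with probability `β/(β+|Λ|-1)` and to each other
neighbour with probability `1/(β+|Λ|-1)`; if `Λ` does not contain the right neighbour, step
uniformly in `Λ`; if `Λ` is empty, stay put. -/
def transProb (β : ℝ) (G : Set (Sym2 V)) (z w : V) : ℝ :=
  if {u : V | s(z, u) ∈ G} = ∅ then (if w = z then 1 else 0)
  else
    if s(z, w) ∈ G then
      (if s(z, ((z.1 + 1, z.2) : V)) ∈ G then
        (if w = ((z.1 + 1, z.2) : V) then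
          β / (β + ({u : V | s(z, u) ∈ G}.ncard : ℝ) - 1)
        else 1 / (β + ({u : V | s(z, u) ∈ G}.ncard : ℝ) - 1))
      else 1 / ({u : V | s(z, u) ∈ G}.ncard : ℝ))
    else 0

/-- `μ` is the law of the β-biased random walk on the subgraph of ℤ² with edge set `G`,
started at `z₀`: a probability measure on trajectories whose cylinder probabilities are
the products of the one-step transition probabilities. -/
def IsWalkLaw (β : ℝ) (G : Set (Sym2 V)) (z₀ : V) (μ : Measure (ℕ → V)) : Prop :=
  IsProbabilityMeasure μ ∧
    ∀ (n : ℕ) (f : ℕ → V), f 0 = z₀ →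
      μ {ω | ∀ i ≤ n, ω i = f i} =
        ENNReal.ofReal (∏ i ∈ Finset.range n, transProb β G (f i) (f (i + 1)))

/-- `b_k = 4 · 3^{k(k-1)/2}`. -/
def bF (k : ℕ) : ℕ := 4 * 3 ^ (k * (k - 1) / 2)

/-- `q_k = 3^k - 1`. -/
def qF (k : ℕ) : ℕ := 3 ^ k - 1

open scoped Classical in
/-- Direction of the abutment of a branch on row index `l` (odd): `+1` if `(l+1)/2` is odd
(so that the root lands on a row reserved for branches of the next order), `-1` otherwise. -/
def dirF (l : ℤ) : ℤ := if Odd ((l + 1) / 2) then 1 else -1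

/-- The set of x-coordinates of tips of order-`k` branches of the fractal configuration:
`0` is a tip of every order, and if `x` is an order-`(k+1)` tip then `x + (j-1)·b_k` is an
order-`k` tip for every `1 ≤ j ≤ q_k` (the order-`k` branches attached to the order-`(k+1)`
branch with tip `x` have their roots at `x + j·b_k - 1`, hence their tips at `x + (j-1)·b_k`). -/
inductive IsTip : ℕ → ℤ → Prop
  | zero (k : ℕ) : IsTip k 0
  | step (k : ℕ) (x : ℤ) (j : ℕ) : IsTip (k + 1) x → 1 ≤ j → j ≤ qF k →
      IsTip k (x + ((j : ℤ) - 1) * (bF k : ℤ))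

/-- The y-coordinate of the row with index `l` reserved for order-`k` branches:
`y = 3 · 2^{k-1} · l` (`l` odd). -/
def rowY (k : ℕ) (l : ℤ) : ℤ := 3 * 2 ^ (k - 1) * l

/-- The fractal configuration ξ: for every order `k ≥ 1`, every odd `l` and every order-`k`
tip `x`, the main part of the branch (the `b_k - 1` horizontal edges from the tip
`(x, 3·2^{k-1}·l)` to the corner `(x + b_k - 1, 3·2^{k-1}·l)`) together with its abutment
(the `3·2^{k-1}` vertical edges from the corner to the root, in the direction `dirF l`). -/
def xiEdges : Set (Sym2 V) :=
  {f | ∃ (k : ℕ) (l x : ℤ), 1 ≤ k ∧ Odd l ∧ IsTip k x ∧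
    ((∃ i : ℕ, i + 2 ≤ bF k ∧
        f = s((x + i, rowY k l), (x + i + 1, rowY k l))) ∨
      (∃ j : ℕ, j < 3 * 2 ^ (k - 1) ∧
        f = s((x + bF k - 1, rowY k l + dirF l * j),
              (x + bF k - 1, rowY k l + dirF l * (j + 1)))))}

/-- `z` lies on the main part of the order-`k` branch with row index `l` and tip
x-coordinate `x`. -/
def OnMainPart (k : ℕ) (l x : ℤ) (z : V) : Prop :=
  z.2 = rowY k l ∧ x ≤ z.1 ∧ z.1 ≤ x + bF k - 1

/-! ### Trajectories of the walk -/

lemma transProb_nonneg {β : ℝ} (hβ : 1 < β) (G : Set (Sym2 V)) (z w : V) :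
    0 ≤ transProb β G z w := by
  have h : (0 : ℝ) ≤ ({u : V | s(z, u) ∈ G}.ncard : ℝ) := Nat.cast_nonneg _
  have h' : 0 ≤ β + ({u : V | s(z, u) ∈ G}.ncard : ℝ) - 1 := by linarith
  unfold transProb
  split_ifs <;> positivity

lemma measurableSet_eval (n : ℕ) (z : V) : MeasurableSet {ω : ℕ → V | ω n = z} :=
  (measurableSet_singleton z).preimage (measurable_pi_apply n)

lemma IsWalkLaw.ae_start {β : ℝ} {G : Set (Sym2 V)} {z₀ : V} {μ : Measure (ℕ → V)}
    (hμ : IsWalkLaw β G z₀ μ) : ∀ᵐ ω ∂μ, ω 0 = z₀ := by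
  have := hμ.1
  have h := hμ.2 0 (fun _ => z₀) rfl
  simp only [Nat.le_zero_eq, forall_eq, Finset.range_zero, Finset.prod_empty,
    ENNReal.ofReal_one] at h
  exact (prob_compl_eq_zero_iff (measurableSet_eval 0 z₀)).mpr h

lemma IsWalkLaw.cylinder_succ {β : ℝ} (hβ : 1 < β) {G : Set (Sym2 V)} {z₀ : V}
    {μ : Measure (ℕ → V)} (hμ : IsWalkLaw β G z₀ μ) (n : ℕ) (f : ℕ → V) :
    μ {ω | ∀ i ≤ n + 1, ω i = f i} =
      μ {ω | ∀ i ≤ n, ω i = f i} * ENNReal.ofReal (transProb β G (f n) (f (n + 1))) := by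
  by_cases h : f 0 = z₀
  · rw [hμ.2 _ f h, hμ.2 _ f h, Finset.prod_range_succ,
      ENNReal.ofReal_mul (Finset.prod_nonneg fun i _ => transProb_nonneg hβ _ _ _)]
  · have key : ∀ m, μ {ω | ∀ i ≤ m, ω i = f i} = 0 := fun m => by
      refine measure_mono_null (fun ω hω => ?_) (ae_iff.mp hμ.ae_start)
      have := hω 0 (Nat.zero_le _)
      simp only [Set.mem_ofPred_eq]
      rw [this]; exact h
    rw [key, key, zero_mul]

lemma measure_eq_tsum_prefix (μ : Measure (ℕ → V)) (n : ℕ) {A : Set (ℕ → V)}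
    (hA : MeasurableSet A) :
    μ A = ∑' g : Fin (n + 1) → V, μ (A ∩ {ω | ∀ i : Fin (n + 1), ω i = g i}) := by
  rw [← measure_iUnion]
  · congr 1
    ext ω
    simp only [Set.mem_iUnion, Set.mem_inter_iff, Set.mem_ofPred_eq]
    exact ⟨fun h => ⟨fun i => ω i, h, fun _ => rfl⟩, fun ⟨_, h, _⟩ => h⟩
  · intro g g' hgg
    refine Set.disjoint_left.mpr fun ω hω hω' => hgg ?_
    ext1 i
    rw [← hω.2 i, ← hω'.2 i]
  · intro g
    refine hA.inter ?_
    rw [Set.ofPred_forall]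
    exact MeasurableSet.iInter fun i => measurableSet_eval _ _

lemma IsWalkLaw.markov {β : ℝ} (hβ : 1 < β) {G : Set (Sym2 V)} {z₀ : V}
    {μ : Measure (ℕ → V)} (hμ : IsWalkLaw β G z₀ μ) (n : ℕ) (z w : V) :
    μ {ω | ω n = z ∧ ω (n + 1) = w} =
      μ {ω | ω n = z} * ENNReal.ofReal (transProb β G z w) := by
  rw [measure_eq_tsum_prefix μ n (A := {ω | ω n = z ∧ ω (n + 1) = w})
      ((measurableSet_eval n z).inter (measurableSet_eval (n + 1) w)),
    measure_eq_tsum_prefix μ n (measurableSet_eval n z), ← ENNReal.tsum_mul_right]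
  congr 1
  ext1 g
  set f : ℕ → V := fun i => if h : i < n + 1 then g ⟨i, h⟩ else w with hf
  have hfi : ∀ i : Fin (n + 1), f i = g i := fun i => dif_pos i.is_lt
  have hfs : f (n + 1) = w := by simp [hf]
  have hcyl : {ω : ℕ → V | ∀ i : Fin (n + 1), ω i = g i} = {ω | ∀ i ≤ n, ω i = f i} := by
    ext ω
    simp only [Set.mem_ofPred_eq]
    constructor
    · intro h i hi
      have := h ⟨i, by omega⟩
      rw [← hfi] at this
      exact this
    · intro h i
      rw [← hfi]
      exact h i (by omega)
  rw [hcyl]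
  by_cases hz : f n = z
  · have h1 : {ω : ℕ → V | ω n = z ∧ ω (n + 1) = w} ∩ {ω | ∀ i ≤ n, ω i = f i} =
        {ω | ∀ i ≤ n + 1, ω i = f i} := by
      ext ω
      simp only [Set.mem_inter_iff, Set.mem_ofPred_eq]
      constructor
      · rintro ⟨⟨_, h2⟩, h3⟩ i hi
        rcases Nat.lt_or_ge n i with h | h
        · obtain rfl : i = n + 1 := by omega
          rw [h2, hfs]
        · exact h3 i h
      · intro h
        exact ⟨⟨by rw [h n (by omega), hz], by rw [h (n + 1) le_rfl, hfs]⟩,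
          fun i hi => h i (by omega)⟩
    have h2 : {ω : ℕ → V | ω n = z} ∩ {ω | ∀ i ≤ n, ω i = f i} = {ω | ∀ i ≤ n, ω i = f i} := by
      refine Set.inter_eq_right.mpr fun ω hω => ?_
      simp only [Set.mem_ofPred_eq]
      rw [hω n le_rfl, hz]
    rw [h1, h2, hμ.cylinder_succ hβ, hz, hfs]
  · have h0 : ∀ A : Set (ℕ → V), A ⊆ {ω | ω n = z} → A ∩ {ω | ∀ i ≤ n, ω i = f i} = ∅ := by
      intro A hA
      refine Set.eq_empty_iff_forall_notMem.mpr fun ω hω => hz ?_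
      rw [← hω.2 n le_rfl]
      exact hA hω.1
    rw [h0 _ (fun ω h => h.1), h0 _ (fun ω h => h), measure_empty, zero_mul]

lemma lintegral_eval_eq_tsum (μ : Measure (ℕ → V)) (n : ℕ) (F : V → ℝ≥0∞) :
    ∫⁻ ω, F (ω n) ∂μ = ∑' z, F z * μ {ω | ω n = z} := by
  have hF : Measurable F := measurable_of_countable F
  rw [← lintegral_map hF (measurable_pi_apply n), lintegral_countable']
  refine tsum_congr fun z => ?_
  rw [Measure.map_apply (measurable_pi_apply n) (measurableSet_singleton z)]
  rfl

lemma IsWalkLaw.measure_eval_succ {β : ℝ} (hβ : 1 < β) {G : Set (Sym2 V)} {z₀ : V}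
    {μ : Measure (ℕ → V)} (hμ : IsWalkLaw β G z₀ μ) (n : ℕ) (w : V) :
    μ {ω | ω (n + 1) = w} =
      ∑' z, μ {ω | ω n = z} * ENNReal.ofReal (transProb β G z w) := by
  simp_rw [← hμ.markov hβ]
  rw [← measure_iUnion]
  · congr 1
    ext ω
    simp
  · intro z z' hzz
    exact Set.disjoint_left.mpr fun ω hω hω' => hzz (hω.1.symm.trans hω'.1)
  · exact fun z => (measurableSet_eval n z).inter (measurableSet_eval (n + 1) w)

lemma IsWalkLaw.lintegral_succ {β : ℝ} (hβ : 1 < β) {G : Set (Sym2 V)} {z₀ : V}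
    {μ : Measure (ℕ → V)} (hμ : IsWalkLaw β G z₀ μ) (n : ℕ) (F : V → ℝ≥0∞) :
    ∫⁻ ω, F (ω (n + 1)) ∂μ =
      ∑' z, (∑' w, F w * ENNReal.ofReal (transProb β G z w)) * μ {ω | ω n = z} := by
  rw [lintegral_eval_eq_tsum]
  simp_rw [hμ.measure_eval_succ hβ, ← ENNReal.tsum_mul_left, ← ENNReal.tsum_mul_right]
  rw [ENNReal.tsum_comm]
  refine tsum_congr fun z => tsum_congr fun w => ?_
  ring

/-! ### Functions with drift bounded below -/

/-- Along the walk, `Good n z` propagates in time, `G` has drift at least `c`, and the increments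
of `G` at time `n` are `O((n + q)^{1/4})`. -/
def HasDrift (β : ℝ) (E : Set (Sym2 V)) (Good : ℕ → V → Prop) (G : V → ℝ) (c K q : ℝ) : Prop :=
  ∀ n z, Good n z → ∃ S : Finset V, (∀ w ∉ S, transProb β E z w = 0) ∧
    (∀ w ∈ S, Good (n + 1) w) ∧ ∑ w ∈ S, transProb β E z w = 1 ∧
    c ≤ ∑ w ∈ S, transProb β E z w * (G w - G z) ∧
    ∀ w ∈ S, (G w - G z) ^ 4 ≤ K * (n + q)

lemma sum_mul_exp_le {ι : Type*} (S : Finset ι) (p d : ι → ℝ) (hp : ∀ i ∈ S, 0 ≤ p i)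
    (hsum : ∑ i ∈ S, p i = 1) {c r D : ℝ} (hc : c ≤ ∑ i ∈ S, p i * d i)
    (hd : ∀ i ∈ S, |d i| ≤ D) (hr : 0 ≤ r) (hrD : r * D ≤ 1) :
    ∑ i ∈ S, p i * Real.exp (-r * d i) ≤ Real.exp (-r * c + r ^ 2 * D ^ 2) := by
  have h1 : ∀ i ∈ S, p i * Real.exp (-r * d i) ≤
      p i - r * (p i * d i) + p i * (r ^ 2 * D ^ 2) := by
    intro i hi
    have habs : |(-r * d i)| ≤ r * D := by
      rw [abs_mul, abs_neg, abs_of_nonneg hr]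
      exact mul_le_mul_of_nonneg_left (hd i hi) hr
    have h2 := (abs_le.mp (Real.abs_exp_sub_one_sub_id_le (habs.trans hrD))).2
    have h3 : (-r * d i) ^ 2 ≤ (r * D) ^ 2 := by
      rw [← sq_abs]
      exact pow_le_pow_left₀ (abs_nonneg _) habs 2
    calc p i * Real.exp (-r * d i) ≤ p i * (1 + -r * d i + r ^ 2 * D ^ 2) :=
          mul_le_mul_of_nonneg_left (by nlinarith) (hp i hi)
      _ = _ := by ring
  calc ∑ i ∈ S, p i * Real.exp (-r * d i)
      ≤ ∑ i ∈ S, (p i - r * (p i * d i) + p i * (r ^ 2 * D ^ 2)) := Finset.sum_le_sum h1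
    _ = 1 - r * ∑ i ∈ S, p i * d i + r ^ 2 * D ^ 2 := by
        rw [Finset.sum_add_distrib, Finset.sum_sub_distrib, hsum, ← Finset.mul_sum,
          ← Finset.sum_mul, hsum, one_mul]
    _ ≤ (-r * c + r ^ 2 * D ^ 2) + 1 := by nlinarith [mul_le_mul_of_nonneg_left hc hr]
    _ ≤ _ := Real.add_one_le_exp _

section Walk

variable {β : ℝ} {E : Set (Sym2 V)} {z₀ : V} {μ : Measure (ℕ → V)} {Good : ℕ → V → Prop}
  {G : V → ℝ} {c K q : ℝ}

lemma HasDrift.ae_good (hβ : 1 < β) (hμ : IsWalkLaw β E z₀ μ) (h₀ : Good 0 z₀)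
    (hG : HasDrift β E Good G c K q) (n : ℕ) : ∀ z, ¬ Good n z → μ {ω | ω n = z} = 0 := by
  induction n with
  | zero =>
    intro z hz
    refine measure_mono_null (fun ω hω => ?_) (ae_iff.mp hμ.ae_start)
    simp only [Set.mem_ofPred_eq] at hω ⊢
    rintro h
    exact hz (by rw [← hω, h]; exact h₀)
  | succ n ih =>
    intro w hw
    rw [hμ.measure_eval_succ hβ]
    refine ENNReal.tsum_eq_zero.mpr fun z => ?_
    by_cases hz : Good n z
    · obtain ⟨S, h1, h2, -⟩ := hG n z hz
      rw [h1 w fun hS => hw (h2 w hS), ENNReal.ofReal_zero, mul_zero]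
    · rw [ih z hz, zero_mul]

lemma HasDrift.lintegral_exp_le (hβ : 1 < β) (hμ : IsWalkLaw β E z₀ μ) (h₀ : Good 0 z₀)
    (hG : HasDrift β E Good G c K q) (hK : 0 ≤ K) {r D : ℝ} (hr : 0 ≤ r)
    (hD : 0 ≤ D) (hrD : r * D ≤ 1) (n : ℕ) (hn : K * (n + q) ≤ D ^ 4) :
    ∫⁻ ω, ENNReal.ofReal (Real.exp (-r * G (ω n))) ∂μ ≤
      ENNReal.ofReal (Real.exp (-r * G z₀ + n * (-r * c + r ^ 2 * D ^ 2))) := by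
  have := hμ.1
  induction n with
  | zero =>
    refine le_of_eq ?_
    rw [lintegral_congr_ae (hμ.ae_start.mono fun ω hω => by
      show _ = ENNReal.ofReal (Real.exp (-r * G z₀)); rw [hω]), lintegral_const]
    simp
  | succ n ih =>
    have hn' : K * (n + q) ≤ D ^ 4 := by push_cast at hn; nlinarith
    rw [hμ.lintegral_succ hβ n (fun z => ENNReal.ofReal (Real.exp (-r * G z)))]
    calc _ ≤ ∑' z, (ENNReal.ofReal (Real.exp (-r * G z)) *
            ENNReal.ofReal (Real.exp (-r * c + r ^ 2 * D ^ 2))) * μ {ω | ω n = z} := by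
          refine ENNReal.tsum_le_tsum fun z => ?_
          by_cases hz : Good n z
          · refine mul_le_mul_left ?_ _
            obtain ⟨S, h1, -, h3, h4, h5⟩ := hG n z hz
            rw [tsum_eq_sum (s := S) fun w hw => by rw [h1 w hw]; simp,
              ← ENNReal.ofReal_mul (Real.exp_nonneg _)]
            simp_rw [← ENNReal.ofReal_mul (Real.exp_nonneg _)]
            rw [← ENNReal.ofReal_sum_of_nonneg fun w _ =>
              mul_nonneg (Real.exp_nonneg _) (transProb_nonneg hβ _ _ _)]
            refine ENNReal.ofReal_le_ofReal ?_
            have key := sum_mul_exp_le S (transProb β E z) (fun w => G w - G z)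
              (fun _ _ => transProb_nonneg hβ _ _ _) h3 h4
              (fun w hw => abs_le_of_sq_le_sq ?_ hD) hr hrD
            · refine le_trans (le_of_eq ?_)
                (mul_le_mul_of_nonneg_left key (Real.exp_nonneg (-r * G z)))
              rw [Finset.mul_sum]
              refine Finset.sum_congr rfl fun w _ => ?_
              rw [mul_left_comm, ← Real.exp_add, mul_comm]
              congr 2
              ring
            · have := (h5 w hw).trans hn'
              exact le_of_sq_le_sq (by nlinarith) (sq_nonneg D)
          · rw [hG.ae_good hβ hμ h₀ n z hz, mul_zero, mul_zero]
      _ = ENNReal.ofReal (Real.exp (-r * c + r ^ 2 * D ^ 2)) *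
            ∫⁻ ω, ENNReal.ofReal (Real.exp (-r * G (ω n))) ∂μ := by
          rw [lintegral_eval_eq_tsum μ n (fun z => ENNReal.ofReal (Real.exp (-r * G z))),
            ← ENNReal.tsum_mul_left]
          refine tsum_congr fun z => ?_
          ring
      _ ≤ ENNReal.ofReal (Real.exp (-r * c + r ^ 2 * D ^ 2)) * _ :=
          mul_le_mul' le_rfl (ih hn')
      _ = _ := by
          rw [← ENNReal.ofReal_mul (Real.exp_nonneg _), ← Real.exp_add]
          congr 2
          push_cast
          ring

lemma HasDrift.measure_le (hβ : 1 < β) (hμ : IsWalkLaw β E z₀ μ) (h₀ : Good 0 z₀)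
    (hG : HasDrift β E Good G c K q) (hK : 1 ≤ K) (hq : 1 ≤ q) {ε : ℝ} (hε : 0 < ε)
    (hε1 : ε ≤ 1) (n : ℕ) :
    μ {ω | G (ω n) ≤ (c - ε) * n + G z₀} ≤
      ENNReal.ofReal (Real.exp (-(ε ^ 2 * n / (4 * √(K * (n + q)))))) := by
  have := hμ.1
  have hn0 : (0 : ℝ) ≤ n := Nat.cast_nonneg n
  have hpos : 1 ≤ K * (n + q) := by nlinarith
  set s := √(K * (n + q)) with hs
  have hs1 : 1 ≤ s := Real.one_le_sqrt.mpr hpos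
  have hss : s ^ 2 = K * (n + q) := Real.sq_sqrt (by linarith)
  set D := √s with hD
  have hD1 : 1 ≤ D := Real.one_le_sqrt.mpr hs1
  have hDD : D ^ 2 = s := Real.sq_sqrt (by linarith)
  set r := ε / (2 * s) with hr
  have hr0 : 0 < r := by positivity
  have hrD : r * D ≤ 1 := by
    rw [hr, div_mul_eq_mul_div, div_le_one (by positivity), ← hDD]
    nlinarith
  have h1 := hG.lintegral_exp_le hβ hμ h₀ (by linarith) hr0.le (by linarith) hrD n
    (by rw [← hss, ← hDD]; exact le_of_eq (by ring))
  have hmeas : Measurable fun ω : ℕ → V => ENNReal.ofReal (Real.exp (-r * G (ω n))) :=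
    (measurable_of_countable fun z : V => ENNReal.ofReal (Real.exp (-r * G z))).comp
      (measurable_pi_apply n)
  have h2 := (mul_meas_ge_le_lintegral (μ := μ) hmeas
    (ENNReal.ofReal (Real.exp (-r * ((c - ε) * n + G z₀))))).trans h1
  have hsub : {ω : ℕ → V | G (ω n) ≤ (c - ε) * n + G z₀} ⊆
      {ω | ENNReal.ofReal (Real.exp (-r * ((c - ε) * n + G z₀))) ≤
        ENNReal.ofReal (Real.exp (-r * G (ω n)))} := by
    intro ω hω
    simp only [Set.mem_ofPred_eq] at hω ⊢
    exact ENNReal.ofReal_le_ofReal (Real.exp_le_exp.mpr (by nlinarith))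
  calc μ {ω | G (ω n) ≤ (c - ε) * n + G z₀}
      ≤ μ {ω | ENNReal.ofReal (Real.exp (-r * ((c - ε) * n + G z₀))) ≤
        ENNReal.ofReal (Real.exp (-r * G (ω n)))} := measure_mono hsub
    _ = ENNReal.ofReal (Real.exp (r * ((c - ε) * n + G z₀))) *
        (ENNReal.ofReal (Real.exp (-r * ((c - ε) * n + G z₀))) *
        μ {ω | ENNReal.ofReal (Real.exp (-r * ((c - ε) * n + G z₀))) ≤
        ENNReal.ofReal (Real.exp (-r * G (ω n)))}) := by
        rw [← mul_assoc, ← ENNReal.ofReal_mul (Real.exp_nonneg _), ← Real.exp_add]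
        simp
    _ ≤ ENNReal.ofReal (Real.exp (r * ((c - ε) * n + G z₀))) *
        ENNReal.ofReal (Real.exp (-r * G z₀ + n * (-r * c + r ^ 2 * D ^ 2))) := by
        gcongr
    _ = _ := by
        rw [← ENNReal.ofReal_mul (Real.exp_nonneg _), ← Real.exp_add, hDD]
        congr 2
        rw [hr]
        field_simp
        ring

/-- A function with drift at least `c` grows at least at rate `c` along the walk. -/
theorem HasDrift.ae_eventually (hβ : 1 < β) (hμ : IsWalkLaw β E z₀ μ) (h₀ : Good 0 z₀)
    (hG : HasDrift β E Good G c K q) (hK : 1 ≤ K) (hq : 1 ≤ q) {ε : ℝ} (hε : 0 < ε)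
    (hε1 : ε ≤ 1) : ∀ᵐ ω ∂μ, ∀ᶠ n : ℕ in atTop, (c - ε) * n + G z₀ ≤ G (ω n) := by
  set κ := ε ^ 2 / (4 * √(K * (1 + q))) with hκ
  have hκ0 : 0 < κ := by positivity
  have hbound : ∀ n : ℕ, Real.exp (-(ε ^ 2 * (n + 1 : ℕ) / (4 * √(K * ((n + 1 : ℕ) + q))))) ≤
      24 / κ ^ 4 * (1 / ((n + 1 : ℕ) : ℝ) ^ 2) := by
    intro n
    set m : ℝ := ((n + 1 : ℕ) : ℝ) with hm
    have hm1 : 1 ≤ m := by rw [hm]; push_cast; linarith [(Nat.cast_nonneg n : (0 : ℝ) ≤ n)]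
    have hy : κ * √m ≤ ε ^ 2 * m / (4 * √(K * (m + q))) := by
      have h1 : √(K * (m + q)) ≤ √(K * (1 + q)) * √m := by
        rw [← Real.sqrt_mul (by positivity)]
        exact Real.sqrt_le_sqrt (by
          nlinarith [mul_nonneg (by linarith : 0 ≤ K)
            (mul_nonneg (by linarith : 0 ≤ q) (by linarith : 0 ≤ m - 1))])
      have h2 : 0 < √(K * (m + q)) := Real.sqrt_pos.mpr (by positivity)
      have h3 : m = √m * √m := (Real.mul_self_sqrt (by linarith)).symm
      have h4 : 0 < √m := Real.sqrt_pos.mpr (by linarith)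
      rw [hκ, div_mul_eq_mul_div, div_le_div_iff₀ (by positivity) (by positivity)]
      calc ε ^ 2 * √m * (4 * √(K * (m + q))) ≤ ε ^ 2 * √m * (4 * (√(K * (1 + q)) * √m)) := by
            gcongr
        _ = ε ^ 2 * (√m * √m) * (4 * √(K * (1 + q))) := by ring
        _ = _ := by rw [← h3]
    have hy0 : 0 < κ * √m := mul_pos hκ0 (Real.sqrt_pos.mpr (by linarith))
    have h5 := Real.pow_div_factorial_le_exp (κ * √m) hy0.le 4
    have h6 : (κ * √m) ^ 4 = κ ^ 4 * m ^ 2 := by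
      have : √m ^ 2 = m := Real.sq_sqrt (by linarith)
      rw [mul_pow]
      congr 1
      rw [← this]; ring_nf; rw [this]
    calc Real.exp (-(ε ^ 2 * m / (4 * √(K * (m + q))))) ≤ Real.exp (-(κ * √m)) :=
          Real.exp_le_exp.mpr (by linarith)
      _ = 1 / Real.exp (κ * √m) := by rw [Real.exp_neg, one_div]
      _ ≤ 1 / ((κ * √m) ^ 4 / (Nat.factorial 4 : ℝ)) :=
          one_div_le_one_div_of_le (by positivity) h5
      _ = _ := by
          rw [h6]
          norm_num [Nat.factorial]
          field_simp
  have hsum : Summable fun n : ℕ => 24 / κ ^ 4 * (1 / ((n + 1 : ℕ) : ℝ) ^ 2) :=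
    (((summable_nat_add_iff 1).mpr
      (Real.summable_one_div_nat_pow.mpr (by norm_num : 1 < 2))).mul_left _)
  have htsum : ∑' n : ℕ, μ {ω | G (ω (n + 1)) ≤ (c - ε) * (n + 1 : ℕ) + G z₀} ≠ ⊤ := by
    refine ne_top_of_le_ne_top (hsum.tsum_ofReal_ne_top) (ENNReal.tsum_le_tsum fun n => ?_)
    exact (hG.measure_le hβ hμ h₀ hK hq hε hε1 (n + 1)).trans
      (ENNReal.ofReal_le_ofReal (hbound n))
  filter_upwards [ae_eventually_notMem htsum] with ω hω
  obtain ⟨N, hN⟩ := eventually_atTop.mp hω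
  filter_upwards [eventually_ge_atTop (N + 1)] with n hn
  obtain ⟨m, rfl⟩ := Nat.exists_eq_succ_of_ne_zero (n := n) (by omega)
  exact (not_le.mp (hN m (by omega))).le

end Walk

/-! ### Arithmetic of the fractal configuration -/

lemma bF_succ (k : ℕ) : bF (k + 1) = 3 ^ k * bF k := by
  have h : (k + 1) * (k + 1 - 1) / 2 = k * (k - 1) / 2 + k := by
    rcases k with _ | k
    · rfl
    · simp only [Nat.add_sub_cancel]
      rw [show (k + 1 + 1) * (k + 1) = (k + 1) * k + (k + 1) * 2 by ring,
        Nat.add_mul_div_right _ _ (by norm_num)]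
  unfold bF
  rw [h, pow_add]
  ring

lemma bF_dvd_bF {i j : ℕ} (h : i ≤ j) : (bF i : ℤ) ∣ bF j := by
  induction j, h using Nat.le_induction with
  | base => exact dvd_rfl
  | succ j _ ih =>
    rw [bF_succ]
    push_cast
    exact ih.mul_left _

lemma four_dvd_bF (k : ℕ) : (4 : ℤ) ∣ bF k := by
  unfold bF
  push_cast
  exact dvd_mul_right _ _

lemma four_le_bF (k : ℕ) : 4 ≤ bF k :=
  Nat.le_mul_of_pos_right 4 (by positivity)

lemma four_le_bF_int (k : ℕ) : (4 : ℤ) ≤ bF k := by exact_mod_cast four_le_bF k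

lemma emod_eq_of_eq {y q m r : ℤ} (h : y = q * m + r) (h0 : 0 ≤ r) (h1 : r < q) : y % q = r := by
  rw [h, Int.mul_add_emod_self_left, Int.emod_eq_of_lt h0 h1]

lemma ediv_eq_of_eq {y q m r : ℤ} (h : y = q * m + r) (h0 : 0 ≤ r) (h1 : r < q) : y / q = m := by
  rw [h, Int.mul_add_ediv_left _ _ (by omega), Int.ediv_eq_zero_of_lt h0 h1, add_zero]

lemma succ_ediv_of_not_dvd {x b : ℤ} (hb : 0 < b) (h : ¬ b ∣ x + 1) :
    (x + 1) / b = x / b := by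
  have h1 := Int.mul_ediv_add_emod x b
  have h2 := Int.emod_lt_of_pos x hb
  have h3 := Int.emod_nonneg x hb.ne'
  refine ediv_eq_of_eq (r := x % b + 1) (by linarith) (by omega) ?_
  by_contra hlt
  exact h ⟨x / b + 1, by rw [mul_add]; omega⟩

lemma succ_emod_of_not_dvd {x b : ℤ} (hb : 0 < b) (h : ¬ b ∣ x + 1) :
    (x + 1) % b = x % b + 1 := by
  have h1 := Int.mul_ediv_add_emod x b
  have h2 := Int.mul_ediv_add_emod (x + 1) b
  rw [succ_ediv_of_not_dvd hb h] at h2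
  linarith

/-- The column `x` lies over the main part of some branch of order `k`: no mixed-radix digit of
`x` of index at least `k` is maximal. -/
def RowOK (k : ℕ) (x : ℤ) : Prop :=
  0 ≤ x ∧ ∀ i, k ≤ i → ¬ ((3 : ℤ) ^ i ∣ x / bF i + 1)

/-- The column `x` contains the abutments of the branches of order `k`. -/
def IsCol (k : ℕ) (x : ℤ) : Prop := (bF k : ℤ) ∣ x + 1 ∧ RowOK k x

/-- The length of an abutment of order `k`. -/
def abutLen (k : ℕ) : ℤ := 3 * 2 ^ (k - 1)

lemma rowY_eq (k : ℕ) (l : ℤ) : rowY k l = abutLen k * l := rfl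

lemma abutLen_succ {k : ℕ} (hk : 1 ≤ k) : abutLen (k + 1) = 2 * abutLen k := by
  obtain ⟨j, rfl⟩ := Nat.exists_eq_add_of_le hk
  simp only [abutLen, add_tsub_cancel_left, Nat.add_sub_cancel]
  rw [add_comm 1 j, pow_succ]
  ring

lemma three_le_abutLen (k : ℕ) : 3 ≤ abutLen k := by
  have : (1 : ℤ) ≤ 2 ^ (k - 1) := one_le_pow₀ (by norm_num)
  unfold abutLen
  linarith

lemma abutLen_of_lt {i k : ℕ} (hi : 1 ≤ i) (h : i < k) :
    ∃ n : ℕ, k = i + 1 + n ∧ abutLen k = 2 * abutLen i * 2 ^ n := by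
  obtain ⟨n, rfl⟩ := Nat.exists_eq_add_of_lt h
  refine ⟨n, by omega, ?_⟩
  rw [show i + n + 1 = (i + n) + 1 by rfl, abutLen_succ (by omega)]
  unfold abutLen
  rw [show i + n - 1 = i - 1 + n by omega, pow_add]
  ring

lemma RowOK.mono {i k : ℕ} {x : ℤ} (h : RowOK i x) (hik : i ≤ k) : RowOK k x :=
  ⟨h.1, fun j hj => h.2 j (hik.trans hj)⟩

lemma RowOK.add_one {k : ℕ} {x : ℤ} (h : RowOK k x) (hd : ¬ (bF k : ℤ) ∣ x + 1) :
    RowOK k (x + 1) := by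
  refine ⟨by linarith [h.1], fun i hi => ?_⟩
  rw [succ_ediv_of_not_dvd (by linarith [four_le_bF_int i]) fun hdi =>
    hd ((bF_dvd_bF hi).trans hdi)]
  exact h.2 i hi

lemma RowOK.sub_one {k : ℕ} {x : ℤ} (h : RowOK k x) (hd : ¬ (bF k : ℤ) ∣ x) :
    RowOK k (x - 1) := by
  have hx : x ≠ 0 := by rintro rfl; exact hd (dvd_zero _)
  refine ⟨by have := h.1; omega, fun i hi => ?_⟩
  rw [← succ_ediv_of_not_dvd (x := x - 1) (by linarith [four_le_bF_int i])
    (by rw [sub_add_cancel]; exact fun hdi => hd ((bF_dvd_bF hi).trans hdi)), sub_add_cancel]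
  exact h.2 i hi

lemma RowOK.of_sub_one {k : ℕ} {x : ℤ} (h : RowOK k (x - 1)) (hd : ¬ (bF k : ℤ) ∣ x) :
    RowOK k x := by
  simpa using h.add_one (by simpa using hd)

lemma RowOK.add {k : ℕ} {x : ℤ} (h : RowOK k x) (hx : (bF k : ℤ) ∣ x) (n : ℕ) (hn : n < bF k) :
    RowOK k (x + n) := by
  induction n with
  | zero => simpa using h
  | succ n ih =>
    push_cast
    rw [← add_assoc]
    refine (ih (by omega)).add_one ?_
    rw [add_assoc, Int.dvd_add_right hx]
    exact fun hd => absurd (Int.le_of_dvd (by omega) hd) (by omega)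

lemma RowOK.sub {k : ℕ} {x : ℤ} (h : RowOK k x) : RowOK k (x - x % bF k) := by
  have hb := four_le_bF_int k
  have key : ∀ n : ℕ, (n : ℤ) ≤ x % bF k → RowOK k (x - n) := by
    intro n
    induction n with
    | zero => intro _; simpa using h
    | succ n ih =>
      intro hn
      push_cast at hn ⊢
      rw [← sub_sub]
      refine (ih (by omega)).sub_one fun hd => ?_
      rw [show x - n = (bF k : ℤ) * (x / bF k) + (x % bF k - n) by
        linarith [Int.mul_ediv_add_emod x (bF k)], Int.dvd_add_right (dvd_mul_right _ _)] at hd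
      have := Int.le_of_dvd (by omega) hd
      have := Int.emod_lt_of_pos x (show (0 : ℤ) < bF k by omega)
      omega
  have h0 := Int.emod_nonneg x (show (bF k : ℤ) ≠ 0 by omega)
  have := key (x % bF k).toNat (by omega)
  rwa [Int.toNat_of_nonneg h0] at this

lemma RowOK.not_dvd {i k : ℕ} {x : ℤ} (h : RowOK i x) (hik : i < k) :
    ¬ (bF k : ℤ) ∣ x + 1 := by
  intro hd
  obtain ⟨m, hm⟩ := (bF_dvd_bF (Nat.succ_le_of_lt hik)).trans hd
  refine h.2 i le_rfl ⟨m, ?_⟩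
  rw [Nat.succ_eq_add_one, bF_succ] at hm
  push_cast at hm
  have hb := four_le_bF_int i
  rw [ediv_eq_of_eq (m := 3 ^ i * m - 1) (r := bF i - 1) (q := bF i) (by linarith) (by omega)
    (by omega)]
  ring

lemma IsCol.le {i k : ℕ} {x : ℤ} (h : RowOK i x) (hk : (bF k : ℤ) ∣ x + 1) : k ≤ i :=
  not_lt.mp fun hlt => h.not_dvd hlt hk

lemma IsCol.unique {i k : ℕ} {x : ℤ} (h : IsCol i x) (h' : IsCol k x) : i = k :=
  le_antisymm (IsCol.le h'.2 h.1) (IsCol.le h.2 h'.1)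

lemma IsTip.rowOK {k : ℕ} {x : ℤ} (h : IsTip k x) : 1 ≤ k → RowOK k x ∧ (bF k : ℤ) ∣ x := by
  induction h with
  | zero k =>
    intro hk
    refine ⟨⟨le_rfl, fun i hi hd => ?_⟩, dvd_zero _⟩
    rw [Int.zero_ediv, zero_add] at hd
    have h1 := Int.le_of_dvd one_pos hd
    have h2 : (3 : ℤ) ^ 1 ≤ 3 ^ i := pow_le_pow_right₀ (by norm_num) (by omega)
    linarith
  | step k x j h hj hjq ih =>
    intro hk
    obtain ⟨h1, h2⟩ := ih (by omega)
    have hb := four_le_bF_int k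
    have hq : (j : ℤ) + 1 ≤ 3 ^ k := by
      have h3 : 1 ≤ 3 ^ k := Nat.one_le_pow _ _ (by norm_num)
      unfold qF at hjq
      have : j + 1 ≤ 3 ^ k := by omega
      exact_mod_cast this
    have hdvd : (bF k : ℤ) ∣ x := (bF_dvd_bF (Nat.le_succ k)).trans h2
    have hlt : (j - 1) * bF k < bF (k + 1) := by
      rw [bF_succ]
      have : j - 1 < 3 ^ k := by
        have : (j : ℤ) < 3 ^ k := by linarith
        have : j < 3 ^ k := by exact_mod_cast this
        omega
      exact Nat.mul_lt_mul_of_pos_right this (by have := four_le_bF k; omega)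
    have h4 := h1.add h2 _ hlt
    push_cast [Nat.cast_sub hj] at h4
    refine ⟨⟨h4.1, fun i hi => ?_⟩, hdvd.add (dvd_mul_left _ _)⟩
    rcases hi.eq_or_lt with rfl | hi
    · obtain ⟨m, hm⟩ := h2
      rw [bF_succ] at hm
      push_cast at hm
      rw [ediv_eq_of_eq (m := 3 ^ k * m + (j - 1)) (r := 0) (by rw [hm]; ring) le_rfl (by omega),
        show (3 : ℤ) ^ k * m + (j - 1) + 1 = 3 ^ k * m + j by ring,
        Int.dvd_add_right (dvd_mul_right _ _)]
      intro hd
      have := Int.le_of_dvd (by omega) hd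
      linarith
    · exact h4.2 i hi

lemma RowOK.isTip {k : ℕ} {x : ℤ} (h : RowOK k x) (hd : (bF k : ℤ) ∣ x) : IsTip k x := by
  have key : ∀ n k : ℕ, ∀ x : ℤ, RowOK k x → (bF k : ℤ) ∣ x → x < bF (k + n) → IsTip k x := by
    intro n
    induction n with
    | zero =>
      intro k x h hd hx
      obtain rfl : x = 0 := Int.eq_zero_of_dvd_of_nonneg_of_lt h.1 hx hd
      exact IsTip.zero k
    | succ n ih =>
      intro k x h hd hx
      have hb := four_le_bF_int k
      have hb' := four_le_bF_int (k + 1)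
      have hx' := (h.mono (Nat.le_succ k)).sub
      have hd' : (bF (k + 1) : ℤ) ∣ x - x % bF (k + 1) := Int.dvd_self_sub_emod
      have htip := ih (k + 1) _ hx' hd' (by
        have := Int.emod_nonneg x (show (bF (k + 1) : ℤ) ≠ 0 by omega)
        rw [show k + 1 + n = k + (n + 1) by ring]
        linarith)
      obtain ⟨m, hm⟩ := hd
      have hmod : x % bF (k + 1) = bF k * (m % 3 ^ k) := by
        rw [bF_succ, hm]
        push_cast
        rw [mul_comm ((3 : ℤ) ^ k), Int.mul_emod_mul_of_pos _ _ (by omega)]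
      have h3 : (0 : ℤ) < 3 ^ k := by positivity
      have hm0 := Int.emod_nonneg m h3.ne'
      have hm1 := Int.emod_lt_of_pos m h3
      have hm2 : m % 3 ^ k ≠ 3 ^ k - 1 := by
        intro heq
        refine h.2 k le_rfl ?_
        rw [hm, Int.mul_ediv_cancel_left _ (by omega)]
        refine ⟨m / 3 ^ k + 1, ?_⟩
        have := Int.mul_ediv_add_emod m (3 ^ k)
        linarith
      have hstep := IsTip.step k _ (m % 3 ^ k + 1).toNat htip (by omega) (by
        have : ((m % 3 ^ k + 1).toNat : ℤ) ≤ ((3 ^ k - 1 : ℕ) : ℤ) := by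
          rw [Int.toNat_of_nonneg (by omega), Nat.cast_sub (Nat.one_le_pow _ _ (by norm_num))]
          push_cast
          omega
        exact_mod_cast this)
      rw [Int.toNat_of_nonneg (by omega), add_sub_cancel_right, mul_comm, ← hmod,
        sub_add_cancel] at hstep
      exact hstep
  obtain ⟨n, hn⟩ : ∃ n : ℕ, x < bF (k + n) := by
    have hlt : ∀ n : ℕ, n < bF (k + n) := by
      intro n
      induction n with
      | zero => have := four_le_bF (k + 0); omega
      | succ n ih =>
        rw [show k + (n + 1) = (k + n) + 1 by ring, bF_succ]
        rcases Nat.eq_zero_or_pos (k + n) with h0 | h0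
        · have := four_le_bF (k + n)
          have : n = 0 := by omega
          rw [h0]; subst this; simp [bF]
        · have : 3 ^ 1 ≤ 3 ^ (k + n) := Nat.pow_le_pow_right (by norm_num) h0
          nlinarith
    refine ⟨x.toNat, ?_⟩
    have h1 : (x.toNat : ℤ) < bF (k + x.toNat) := by exact_mod_cast hlt x.toNat
    have h2 := h.1
    omega
  exact key n k x h hd hn

lemma bF_emod_lt (k : ℕ) (x : ℤ) : 0 ≤ x % bF k ∧ x % bF k < bF k :=
  ⟨Int.emod_nonneg _ (by linarith [four_le_bF_int k]),
    Int.emod_lt_of_pos _ (by linarith [four_le_bF_int k])⟩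

/-! ### Edges and neighbourhoods -/

/-- The edge from `(x, y)` to `(x + 1, y)` belongs to the main part of a branch. -/
def HEdge (x y : ℤ) : Prop :=
  ∃ (k : ℕ) (l : ℤ), 1 ≤ k ∧ Odd l ∧ y = abutLen k * l ∧ RowOK k x ∧ ¬ (bF k : ℤ) ∣ x + 1

/-- The edge from `(x, y)` to `(x, y + 1)` belongs to an abutment. -/
def VEdge (x y : ℤ) : Prop :=
  ∃ k : ℕ, 1 ≤ k ∧ IsCol k x ∧ abutLen k ≤ y % (4 * abutLen k) ∧
    y % (4 * abutLen k) < 3 * abutLen k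

lemma dirF_of_one (m : ℤ) : dirF (4 * m + 1) = 1 := by
  have : Odd ((4 * m + 1 + 1) / 2) := ⟨m, by omega⟩
  exact if_pos this

lemma dirF_of_three (m : ℤ) : dirF (4 * m + 3) = -1 := by
  have : ¬ Odd ((4 * m + 3 + 1) / 2) := by
    rw [Int.not_odd_iff_even]
    exact ⟨m + 1, by omega⟩
  exact if_neg this

lemma odd_cases {l : ℤ} (h : Odd l) : ∃ m, l = 4 * m + 1 ∨ l = 4 * m + 3 := by
  obtain ⟨n, rfl⟩ := h
  obtain ⟨m, rfl | rfl⟩ := Int.even_or_odd' n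
  · exact ⟨m, Or.inl (by ring)⟩
  · exact ⟨m, Or.inr (by ring)⟩

lemma IsCol.isTip {k : ℕ} {x : ℤ} (h : IsCol k x) : IsTip k (x + 1 - bF k) := by
  obtain ⟨m, hm⟩ := h.1
  have hmod : x % bF k = bF k - 1 :=
    emod_eq_of_eq (m := m - 1) (by linarith) (by linarith [four_le_bF_int k]) (by linarith)
  have h1 := h.2.sub
  rw [hmod, show x - (bF k - 1 : ℤ) = x + 1 - bF k by ring] at h1
  exact h1.isTip (h.1.sub dvd_rfl)

lemma IsTip.isCol {k : ℕ} {x : ℤ} (hk : 1 ≤ k) (h : IsTip k x) : IsCol k (x + bF k - 1) := by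
  obtain ⟨h1, h2⟩ := h.rowOK hk
  have hb := four_le_bF k
  refine ⟨by rw [sub_add_cancel]; exact h2.add dvd_rfl, ?_⟩
  have := h1.add h2 (bF k - 1) (by omega)
  rwa [Nat.cast_sub (by omega), Nat.cast_one, ← add_sub_assoc] at this

lemma mem_xiEdges_iff (e : Sym2 V) : e ∈ xiEdges ↔
    (∃ x y, HEdge x y ∧ e = s(((x, y) : V), ((x + 1, y) : V))) ∨
      (∃ x y, VEdge x y ∧ e = s(((x, y) : V), ((x, y + 1) : V))) := by
  constructor
  · rintro ⟨k, l, x, hk, hl, hx, ⟨i, hi, rfl⟩ | ⟨j, hj, rfl⟩⟩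
    · left
      obtain ⟨h1, h2⟩ := hx.rowOK hk
      refine ⟨x + i, rowY k l, ⟨k, l, hk, hl, rfl, h1.add h2 i (by omega), ?_⟩, rfl⟩
      rw [add_assoc, Int.dvd_add_right h2]
      intro hd
      have := Int.le_of_dvd (by omega) hd
      omega
    · right
      have hj' : (j : ℤ) < abutLen k := by unfold abutLen; exact_mod_cast hj
      obtain ⟨m, rfl | rfl⟩ := odd_cases hl
      · refine ⟨x + bF k - 1, abutLen k * (4 * m + 1) + j, ⟨k, hk, hx.isCol hk, ?_⟩, ?_⟩
        · rw [emod_eq_of_eq (m := m) (r := abutLen k + j) (by ring) (by omega) (by omega)]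
          omega
        · rw [dirF_of_one, rowY_eq]
          simp [add_assoc]
      · refine ⟨x + bF k - 1, abutLen k * (4 * m + 3) - j - 1, ⟨k, hk, hx.isCol hk, ?_⟩, ?_⟩
        · rw [emod_eq_of_eq (m := m) (r := 3 * abutLen k - j - 1) (by ring) (by omega) (by omega)]
          omega
        · rw [dirF_of_three, rowY_eq]
          simp only [Sym2.eq_iff, Prod.mk.injEq]
          exact Or.inr ⟨⟨trivial, by ring⟩, trivial, by ring⟩
  · rintro (⟨x, y, ⟨k, l, hk, hl, rfl, hx, hd⟩, rfl⟩ | ⟨x, y, ⟨k, hk, hx, h1, h2⟩, rfl⟩)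
    · obtain ⟨h3, h4⟩ := bF_emod_lt k x
      refine ⟨k, l, x - x % bF k, hk, hl, hx.sub.isTip Int.dvd_self_sub_emod,
        Or.inl ⟨(x % bF k).toNat, ?_, ?_⟩⟩
      · by_contra hlt
        refine hd ⟨x / bF k + 1, ?_⟩
        have := Int.mul_ediv_add_emod x (bF k)
        rw [mul_add]
        omega
      · rw [Int.toNat_of_nonneg h3, sub_add_cancel, rowY_eq]
    · have hy := Int.mul_ediv_add_emod y (4 * abutLen k)
      set m := y / (4 * abutLen k)
      set r := y % (4 * abutLen k)
      rcases lt_or_ge r (2 * abutLen k) with h3 | h3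
      · refine ⟨k, 4 * m + 1, _, hk, ⟨2 * m, by ring⟩, hx.isTip,
          Or.inr ⟨(r - abutLen k).toNat, ?_, ?_⟩⟩
        · have : ((r - abutLen k).toNat : ℤ) < ((3 * 2 ^ (k - 1) : ℕ) : ℤ) := by
            rw [Int.toNat_of_nonneg (by omega)]
            push_cast
            change r - abutLen k < abutLen k
            omega
          exact_mod_cast this
        · rw [dirF_of_one, rowY_eq, Int.toNat_of_nonneg (by omega), ← hy]
          simp only [Sym2.eq_iff, Prod.mk.injEq]
          exact Or.inl ⟨⟨by ring, by ring⟩, by ring, by ring⟩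
      · refine ⟨k, 4 * m + 3, _, hk, ⟨2 * m + 1, by ring⟩, hx.isTip,
          Or.inr ⟨(3 * abutLen k - 1 - r).toNat, ?_, ?_⟩⟩
        · have : ((3 * abutLen k - 1 - r).toNat : ℤ) < ((3 * 2 ^ (k - 1) : ℕ) : ℤ) := by
            rw [Int.toNat_of_nonneg (by omega)]
            push_cast
            change 3 * abutLen k - 1 - r < abutLen k
            omega
          exact_mod_cast this
        · rw [dirF_of_three, rowY_eq, Int.toNat_of_nonneg (by omega), ← hy, Sym2.eq_swap]
          simp only [Sym2.eq_iff, Prod.mk.injEq]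
          exact Or.inl ⟨⟨by ring, by ring⟩, by ring, by ring⟩

lemma mem_neighbors_iff (x y : ℤ) (u : V) : s(((x, y) : V), u) ∈ xiEdges ↔
    (u = (x + 1, y) ∧ HEdge x y) ∨ (u = (x - 1, y) ∧ HEdge (x - 1) y) ∨
      (u = (x, y + 1) ∧ VEdge x y) ∨ (u = (x, y - 1) ∧ VEdge x (y - 1)) := by
  obtain ⟨a, b⟩ := u
  rw [mem_xiEdges_iff]
  simp only [Sym2.eq_iff, Prod.mk.injEq]
  constructor
  · rintro (⟨x', y', h, (⟨⟨rfl, rfl⟩, rfl, rfl⟩ | ⟨⟨rfl, rfl⟩, rfl, rfl⟩)⟩ |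
      ⟨x', y', h, (⟨⟨rfl, rfl⟩, rfl, rfl⟩ | ⟨⟨rfl, rfl⟩, rfl, rfl⟩)⟩) <;> simp [h]
  · rintro (⟨⟨rfl, rfl⟩, h⟩ | ⟨⟨rfl, rfl⟩, h⟩ | ⟨⟨rfl, rfl⟩, h⟩ | ⟨⟨rfl, rfl⟩, h⟩)
    · exact Or.inl ⟨_, _, h, by simp⟩
    · exact Or.inl ⟨_, _, h, by simp⟩
    · exact Or.inr ⟨_, _, h, by simp⟩
    · exact Or.inr ⟨_, _, h, by simp⟩

lemma abutLen_pos (k : ℕ) : 0 < abutLen k := by linarith [three_le_abutLen k]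

lemma four_mul_abutLen_dvd {i k : ℕ} (hi : 1 ≤ i) (h : i + 1 < k) :
    4 * abutLen i ∣ abutLen k := by
  obtain ⟨n, -, hn⟩ := abutLen_of_lt (Nat.le_add_left 1 i) h
  rw [hn, abutLen_succ hi]
  exact ⟨2 ^ n, by ring⟩

lemma abutLen_mul_odd_inj {i k : ℕ} (hi : 1 ≤ i) (hk : 1 ≤ k) {l m : ℤ} (hl : Odd l) (hm : Odd m)
    (h : abutLen i * l = abutLen k * m) : i = k := by
  have key : ∀ {i k : ℕ} {l m : ℤ}, 1 ≤ i → Odd l → i < k → abutLen i * l ≠ abutLen k * m := by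
    intro i k l m hi hl hik h
    obtain ⟨n, -, hn⟩ := abutLen_of_lt hi hik
    rw [hn, mul_comm 2, mul_assoc, mul_assoc] at h
    have h2 := mul_left_cancel₀ (abutLen_pos i).ne' h
    rw [h2] at hl
    exact Int.not_even_iff_odd.mpr hl (even_two_mul _)
  rcases lt_trichotomy i k with h1 | h1 | h1
  · exact absurd h (key hi hl h1)
  · exact h1
  · have := @key k i m l hk hm h1
    exact absurd h.symm this

/-- `z` lies on the main part of a branch of order `k`. -/
def IsRow (k : ℕ) (z : V) : Prop := (∃ l : ℤ, Odd l ∧ z.2 = abutLen k * l) ∧ RowOK k z.1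

/-- `z` lies in the interior of the abutment of a branch of order `k`. -/
def IsAbut (k : ℕ) (z : V) : Prop :=
  IsCol k z.1 ∧ abutLen k < z.2 % (4 * abutLen k) ∧ z.2 % (4 * abutLen k) < 3 * abutLen k ∧
    z.2 % (4 * abutLen k) ≠ 2 * abutLen k

lemma IsRow.unique {i k : ℕ} {z : V} (hi : 1 ≤ i) (hk : 1 ≤ k) (h : IsRow i z) (h' : IsRow k z) :
    i = k := by
  obtain ⟨⟨l, hl, h1⟩, -⟩ := h
  obtain ⟨⟨m, hm, h2⟩, -⟩ := h'
  exact abutLen_mul_odd_inj hi hk hl hm (h1.symm.trans h2)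

lemma IsRow.emod {k : ℕ} {x y : ℤ} (h : IsRow k (x, y)) :
    y % (4 * abutLen k) = abutLen k ∨ y % (4 * abutLen k) = 3 * abutLen k := by
  obtain ⟨⟨l, hl, rfl : y = _⟩, -⟩ := h
  have := abutLen_pos k
  obtain ⟨m, rfl | rfl⟩ := odd_cases hl
  · exact Or.inl (emod_eq_of_eq (m := m) (by ring) (by omega) (by omega))
  · exact Or.inr (emod_eq_of_eq (m := m) (by ring) (by omega) (by omega))

lemma exists_odd_of_emod {L y : ℤ} (h : y % (4 * L) = L ∨ y % (4 * L) = 3 * L) :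
    ∃ l, Odd l ∧ y = L * l := by
  have hy := Int.mul_ediv_add_emod y (4 * L)
  rcases h with h | h <;> rw [h] at hy
  · exact ⟨4 * (y / (4 * L)) + 1, ⟨2 * (y / (4 * L)), by ring⟩, by linarith⟩
  · exact ⟨4 * (y / (4 * L)) + 3, ⟨2 * (y / (4 * L)) + 1, by ring⟩, by linarith⟩

lemma exists_odd_of_emod_succ {k : ℕ} (hk : 1 ≤ k) {y : ℤ}
    (h : y % (4 * abutLen k) = 2 * abutLen k) : ∃ l, Odd l ∧ y = abutLen (k + 1) * l := by
  have hy := Int.mul_ediv_add_emod y (4 * abutLen k)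
  rw [h] at hy
  refine ⟨2 * (y / (4 * abutLen k)) + 1, ⟨_, rfl⟩, ?_⟩
  rw [abutLen_succ hk]
  linarith

lemma emod_of_row_succ {k : ℕ} (hk : 1 ≤ k) {l : ℤ} (hl : Odd l) :
    (abutLen (k + 1) * l) % (4 * abutLen k) = 2 * abutLen k := by
  have := abutLen_pos k
  obtain ⟨m, rfl⟩ := hl
  exact emod_eq_of_eq (m := m) (by rw [abutLen_succ hk]; ring) (by omega) (by omega)

lemma emod_of_row_far {i k : ℕ} (hi : 1 ≤ i) (h : i + 1 < k) (l : ℤ) :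
    (abutLen k * l) % (4 * abutLen i) = 0 :=
  Int.emod_eq_zero_of_dvd ((four_mul_abutLen_dvd hi h).mul_right l)

lemma emod_sub_one {y q : ℤ} (hq : 0 < q) (h : y % q ≠ 0) : (y - 1) % q = y % q - 1 := by
  have h0 := Int.emod_nonneg y hq.ne'
  have h1 := Int.emod_lt_of_pos y hq
  exact emod_eq_of_eq (m := y / q) (by linarith [Int.mul_ediv_add_emod y q]) (by omega) (by omega)

lemma emod_sub_one_of_zero {y q : ℤ} (hq : 0 < q) (h : y % q = 0) : (y - 1) % q = q - 1 :=
  emod_eq_of_eq (m := y / q - 1) (by linarith [Int.mul_ediv_add_emod y q]) (by omega) (by omega)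

lemma emod_add_one {y q : ℤ} (hq : 0 < q) (h : y % q + 1 < q) : (y + 1) % q = y % q + 1 := by
  have h0 := Int.emod_nonneg y hq.ne'
  exact emod_eq_of_eq (m := y / q) (by linarith [Int.mul_ediv_add_emod y q]) (by omega) h

lemma IsCol.vEdge_iff {k : ℕ} (hk : 1 ≤ k) {x : ℤ} (h : IsCol k x) (y : ℤ) :
    VEdge x y ↔ abutLen k ≤ y % (4 * abutLen k) ∧ y % (4 * abutLen k) < 3 * abutLen k := by
  refine ⟨fun ⟨i, _, hi, h1⟩ => ?_, fun h1 => ⟨k, hk, h, h1⟩⟩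
  rwa [h.unique hi]

lemma IsCol.vEdge_sub_one_iff {k : ℕ} (hk : 1 ≤ k) {x : ℤ} (h : IsCol k x) (y : ℤ) :
    VEdge x (y - 1) ↔ abutLen k < y % (4 * abutLen k) ∧ y % (4 * abutLen k) ≤ 3 * abutLen k := by
  rw [h.vEdge_iff hk]
  have hL := abutLen_pos k
  by_cases h0 : y % (4 * abutLen k) = 0
  · rw [emod_sub_one_of_zero (by omega) h0]
    omega
  · rw [emod_sub_one (by omega) h0]
    omega

/-- A vertical edge at a vertex of a row of order `k` belongs to an abutment of order `k`
or `k - 1`. -/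
lemma IsRow.col_cases {k i : ℕ} {x y : ℤ} (h : IsRow k (x, y)) (hi : 1 ≤ i) (hc : IsCol i x)
    (hv : VEdge x y ∨ VEdge x (y - 1)) : i = k ∨ i + 1 = k := by
  obtain ⟨⟨l, hl, rfl : y = _⟩, hr⟩ := h
  have h1 := IsCol.le hr hc.1
  by_contra! h2
  have h0 := emod_of_row_far hi (show i + 1 < k by omega) l
  have := abutLen_pos i
  rw [hc.vEdge_iff hi, hc.vEdge_sub_one_iff hi, h0] at hv
  omega

lemma IsRow.hEdge_iff {k : ℕ} (hk : 1 ≤ k) {x y : ℤ} (h : IsRow k (x, y)) :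
    HEdge x y ↔ ¬ (bF k : ℤ) ∣ x + 1 := by
  obtain ⟨⟨l, hl, rfl : y = _⟩, hr⟩ := h
  refine ⟨fun ⟨i, m, hi, hm, he, _, hd⟩ => ?_, fun hd => ⟨k, l, hk, hl, rfl, hr, hd⟩⟩
  rwa [abutLen_mul_odd_inj hk hi hl hm he]

lemma IsRow.hEdge_sub_one_iff {k : ℕ} (hk : 1 ≤ k) {x y : ℤ} (h : IsRow k (x, y)) :
    HEdge (x - 1) y ↔ ¬ (bF k : ℤ) ∣ x := by
  obtain ⟨⟨l, hl, rfl : y = _⟩, hr⟩ := h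
  refine ⟨fun ⟨i, m, hi, hm, he, _, hd⟩ => ?_,
    fun hd => ⟨k, l, hk, hl, rfl, hr.sub_one hd, by rwa [sub_add_cancel]⟩⟩
  rw [sub_add_cancel] at hd
  rwa [abutLen_mul_odd_inj hk hi hl hm he]

lemma not_dvd_of_dvd_succ {k : ℕ} {x : ℤ} (h : (bF k : ℤ) ∣ x + 1) (i : ℕ) :
    ¬ (bF i : ℤ) ∣ x := by
  intro h1
  have h2 := (four_dvd_bF k).trans h
  have h3 := (four_dvd_bF i).trans h1
  omega

/-- Neighbours of the corner of a branch. -/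
lemma IsRow.neighbors_corner {k : ℕ} (hk : 1 ≤ k) {x y : ℤ} (h : IsRow k (x, y))
    (hd : (bF k : ℤ) ∣ x + 1) : ∃ y', (∀ u, s(((x, y) : V), u) ∈ xiEdges ↔
      u ∈ ({(x - 1, y), (x, y')} : Finset V)) ∧ abutLen k ≤ y' % (4 * abutLen k) ∧
        y' % (4 * abutLen k) ≤ 3 * abutLen k ∧
        |y' % (4 * abutLen k) - 2 * abutLen k| = abutLen k - 1 := by
  have hc : IsCol k x := ⟨hd, h.2⟩
  have hL := three_le_abutLen k
  have h1 := h.hEdge_iff hk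
  have h2 := h.hEdge_sub_one_iff hk
  have h3 := hc.vEdge_iff hk y
  have h4 := hc.vEdge_sub_one_iff hk y
  have h5 := not_dvd_of_dvd_succ hd k
  rcases h.emod with he | he
  · have h6 := emod_add_one (y := y) (q := 4 * abutLen k) (by omega) (by omega)
    refine ⟨y + 1, fun u => ?_, ?_⟩
    · rw [mem_neighbors_iff, h1, h2, h3, h4, he]
      have : ¬ abutLen k < abutLen k := lt_irrefl _
      have : abutLen k < 3 * abutLen k := by omega
      simp [hd, h5, this]
    · rw [h6, he, show abutLen k + 1 - 2 * abutLen k = -(abutLen k - 1) by ring, abs_neg,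
        abs_of_nonneg (by omega)]
      omega
  · have h6 := emod_sub_one (y := y) (q := 4 * abutLen k) (by omega) (by omega)
    refine ⟨y - 1, fun u => ?_, ?_⟩
    · rw [mem_neighbors_iff, h1, h2, h3, h4, he]
      have : abutLen k < 3 * abutLen k := by omega
      simp [hd, h5, this]
    · rw [h6, he, show 3 * abutLen k - 1 - 2 * abutLen k = abutLen k - 1 by ring,
        abs_of_nonneg (by omega)]
      omega

lemma IsRow.not_vEdge {k : ℕ} {x y : ℤ} (h : IsRow k (x, y))
    (hd : ¬ (bF k : ℤ) ∣ x + 1) (hc : ¬ (2 ≤ k ∧ IsCol (k - 1) x)) :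
    ¬ VEdge x y ∧ ¬ VEdge x (y - 1) := by
  rw [← not_or]
  intro hv
  obtain ⟨i, hi, hci⟩ : ∃ i, 1 ≤ i ∧ IsCol i x := by
    obtain ⟨i, hi, hci, -⟩ | ⟨i, hi, hci, -⟩ := hv <;> exact ⟨i, hi, hci⟩
  obtain rfl | rfl := h.col_cases hi hci hv
  · exact hd hci.1
  · exact hc ⟨by omega, by simpa using hci⟩

/-- Neighbours of the tip of a branch. -/
lemma IsRow.neighbors_tip {k : ℕ} (hk : 1 ≤ k) {x y : ℤ} (h : IsRow k (x, y))
    (hd : (bF k : ℤ) ∣ x) (u : V) : s(((x, y) : V), u) ∈ xiEdges ↔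
      u ∈ ({(x + 1, y)} : Finset V) := by
  have hd' : ¬ (bF k : ℤ) ∣ x + 1 := fun h' => not_dvd_of_dvd_succ h' k hd
  obtain ⟨h3, h4⟩ := h.not_vEdge hd' fun hc => not_dvd_of_dvd_succ hc.2.1 k hd
  rw [mem_neighbors_iff, h.hEdge_iff hk, h.hEdge_sub_one_iff hk]
  simp [hd, hd', h3, h4]

/-- Neighbours of a vertex of a main part which is neither its tip, nor its corner, nor a root. -/
lemma IsRow.neighbors_plain {k : ℕ} (hk : 1 ≤ k) {x y : ℤ} (h : IsRow k (x, y))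
    (hd : ¬ (bF k : ℤ) ∣ x) (hd' : ¬ (bF k : ℤ) ∣ x + 1) (hc : ¬ (2 ≤ k ∧ IsCol (k - 1) x))
    (u : V) : s(((x, y) : V), u) ∈ xiEdges ↔ u ∈ ({(x + 1, y), (x - 1, y)} : Finset V) := by
  obtain ⟨h3, h4⟩ := h.not_vEdge hd' hc
  rw [mem_neighbors_iff, h.hEdge_iff hk, h.hEdge_sub_one_iff hk]
  simp [hd, hd', h3, h4]

/-- Neighbours of the root of a branch. -/
lemma IsRow.neighbors_root {k : ℕ} (hk : 1 ≤ k) {x y : ℤ} (h : IsRow (k + 1) (x, y))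
    (hc : IsCol k x) (u : V) : s(((x, y) : V), u) ∈ xiEdges ↔
      u ∈ ({(x + 1, y), (x - 1, y), (x, y + 1), (x, y - 1)} : Finset V) := by
  have hd : ¬ (bF (k + 1) : ℤ) ∣ x + 1 := hc.2.not_dvd (Nat.lt_succ_self k)
  have hd' : ¬ (bF (k + 1) : ℤ) ∣ x := not_dvd_of_dvd_succ hc.1 _
  have h1 := h.hEdge_iff (by omega)
  have h2 := h.hEdge_sub_one_iff (by omega)
  obtain ⟨⟨l, hl, rfl : y = _⟩, hr⟩ := h
  have hL := three_le_abutLen k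
  have h3 : VEdge x (abutLen (k + 1) * l) := by
    rw [hc.vEdge_iff hk, emod_of_row_succ hk hl]
    omega
  have h4 : VEdge x (abutLen (k + 1) * l - 1) := by
    rw [hc.vEdge_sub_one_iff hk, emod_of_row_succ hk hl]
    omega
  rw [mem_neighbors_iff, h1, h2]
  simp [hd, hd', h3, h4]

lemma IsAbut.not_rowOK {k : ℕ} (hk : 1 ≤ k) {x y : ℤ} (h : IsAbut k (x, y)) {i : ℕ} (hi : 1 ≤ i)
    {l : ℤ} (hl : Odd l) (hy : y = abutLen i * l) : ¬ RowOK i x := by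
  intro hr
  obtain ⟨hc, h1, h2, h3⟩ := h
  dsimp only at hc h1 h2 h3
  subst hy
  rcases (IsCol.le hr hc.1).eq_or_lt with rfl | hlt
  · rcases IsRow.emod (k := k) (x := x) ⟨⟨l, hl, rfl⟩, hr⟩ with h | h <;> omega
  · rcases (Nat.succ_le_of_lt hlt).eq_or_lt with rfl | hlt
    · exact h3 (emod_of_row_succ hk hl)
    · have := emod_of_row_far hk hlt l
      have := abutLen_pos k
      omega

/-- Neighbours of an interior vertex of an abutment. -/
lemma IsAbut.neighbors {k : ℕ} (hk : 1 ≤ k) {x y : ℤ} (h : IsAbut k (x, y)) (u : V) :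
    s(((x, y) : V), u) ∈ xiEdges ↔ u ∈ ({(x, y + 1), (x, y - 1)} : Finset V) := by
  have h4 : ¬ HEdge x y := fun ⟨i, l, hi, hl, he, hr, _⟩ => h.not_rowOK hk hi hl he hr
  have h5 : ¬ HEdge (x - 1) y := fun ⟨i, l, hi, hl, he, hr, hd⟩ =>
    h.not_rowOK hk hi hl he (hr.of_sub_one (by rwa [sub_add_cancel] at hd))
  obtain ⟨hc, h1, h2, -⟩ := h
  have h6 : VEdge x y := (hc.vEdge_iff hk y).2 ⟨h1.le, h2⟩
  have h7 : VEdge x (y - 1) := (hc.vEdge_sub_one_iff hk y).2 ⟨h1, h2.le⟩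
  rw [mem_neighbors_iff]
  simp [h4, h5, h6, h7]

/-! ### One-step estimates -/

/-- From `z` the walk moves to vertices satisfying `P`, with drift of `G` at least `c` and
increments of `G` bounded by `B`. -/
def StepBound (β : ℝ) (E : Set (Sym2 V)) (P : V → Prop) (G : V → ℝ) (z : V) (c B : ℝ) : Prop :=
  ∃ S : Finset V, (∀ w ∉ S, transProb β E z w = 0) ∧ (∀ w ∈ S, P w) ∧
    ∑ w ∈ S, transProb β E z w = 1 ∧
    c ≤ ∑ w ∈ S, transProb β E z w * (G w - G z) ∧ ∀ w ∈ S, |G w - G z| ≤ B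

lemma ncard_neighbors {E : Set (Sym2 V)} {z : V} {S : Finset V}
    (hS : ∀ u, s(z, u) ∈ E ↔ u ∈ S) : {u : V | s(z, u) ∈ E}.ncard = S.card := by
  rw [← Set.ncard_coe_finset]
  congr 1
  ext u
  exact hS u

lemma neighbors_ne_empty {E : Set (Sym2 V)} {z : V} {S : Finset V}
    (hS : ∀ u, s(z, u) ∈ E ↔ u ∈ S) (hne : S.Nonempty) : {u : V | s(z, u) ∈ E} ≠ ∅ := by
  obtain ⟨u, hu⟩ := hne
  exact Set.nonempty_iff_ne_empty.1 ⟨u, (hS u).2 hu⟩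

lemma stepBound_of_right {β : ℝ} (hβ : 0 < β) {E : Set (Sym2 V)} {P : V → Prop} {G : V → ℝ} {z r : V}
    {c B : ℝ} {T : Finset V} (hr : r = (z.1 + 1, z.2)) (hT : r ∉ T)
    (hS : ∀ u, s(z, u) ∈ E ↔ u ∈ insert r T) (hP : ∀ w ∈ insert r T, P w)
    (hB : ∀ w ∈ insert r T, |G w - G z| ≤ B)
    (hc : c * (β + T.card) ≤ β * (G r - G z) + ∑ w ∈ T, (G w - G z)) :
    StepBound β E P G z c B := by
  have hpos : 0 < β + T.card := by positivity
  have hrE : s(z, ((z.1 + 1, z.2) : V)) ∈ E := (hS _).2 (by simp [hr])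
  have hcard : β + (((insert r T).card : ℕ) : ℝ) - 1 = β + T.card := by
    rw [Finset.card_insert_of_notMem hT]
    push_cast
    ring
  have hne := neighbors_ne_empty hS (Finset.insert_nonempty r T)
  have hpr : transProb β E z r = β / (β + T.card) := by
    rw [transProb, if_neg hne, hr, if_pos hrE, if_pos hrE, if_pos rfl, ncard_neighbors hS, hcard]
  have hpT : ∀ w ∈ T, transProb β E z w = 1 / (β + T.card) := by
    intro w hw
    rw [transProb, if_neg hne, if_pos ((hS w).2 (Finset.mem_insert_of_mem hw)), if_pos hrE,
      if_neg (fun h => hT (by rwa [hr, ← h])), ncard_neighbors hS, hcard]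
  refine ⟨insert r T, fun w hw => ?_, hP, ?_, ?_, hB⟩
  · rw [transProb, if_neg hne, if_neg (by rwa [hS])]
  · rw [Finset.sum_insert hT, Finset.sum_congr rfl hpT, hpr, Finset.sum_const, nsmul_eq_mul]
    field_simp
  · rw [Finset.sum_insert hT, Finset.sum_congr rfl fun w hw => by rw [hpT w hw], hpr,
      ← Finset.mul_sum]
    calc c = c * (β + T.card) / (β + T.card) := by field_simp
      _ ≤ (β * (G r - G z) + ∑ w ∈ T, (G w - G z)) / (β + T.card) := by gcongr
      _ = _ := by ring

lemma stepBound_of_not_right {β : ℝ} {E : Set (Sym2 V)} {P : V → Prop} {G : V → ℝ} {z : V}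
    {c B : ℝ} {T : Finset V} (hne : T.Nonempty) (hT : ((z.1 + 1, z.2) : V) ∉ T)
    (hS : ∀ u, s(z, u) ∈ E ↔ u ∈ T) (hP : ∀ w ∈ T, P w)
    (hB : ∀ w ∈ T, |G w - G z| ≤ B) (hc : c * T.card ≤ ∑ w ∈ T, (G w - G z)) :
    StepBound β E P G z c B := by
  have hpos : (0 : ℝ) < T.card := by exact_mod_cast hne.card_pos
  have hne' := neighbors_ne_empty hS hne
  have hpT : ∀ w ∈ T, transProb β E z w = 1 / T.card := by
    intro w hw
    rw [transProb, if_neg hne', if_pos ((hS w).2 hw), if_neg (by rwa [hS]), ncard_neighbors hS]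
  refine ⟨T, fun w hw => ?_, hP, ?_, ?_, hB⟩
  · rw [transProb, if_neg hne', if_neg (by rwa [hS])]
  · rw [Finset.sum_congr rfl hpT, Finset.sum_const, nsmul_eq_mul]
    field_simp
  · rw [Finset.sum_congr rfl fun w hw => by rw [hpT w hw], ← Finset.mul_sum]
    calc c = c * T.card / T.card := by field_simp
      _ ≤ (∑ w ∈ T, (G w - G z)) / T.card := by gcongr
      _ = _ := by ring

/-! ### Potentials on the fractal configuration -/

open scoped Classical in
/-- The function on the vertices of the fractal configuration given by `gr k` on the rows of order
`k` and by `ga k` on the abutments of order `k`, as a function of the distance to the root. -/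
def glue (gr : ℕ → ℤ → ℝ) (ga : ℕ → ℤ → ℤ → ℝ) (z : V) : ℝ :=
  if h : ∃ k, 1 ≤ k ∧ IsRow k z then gr h.choose z.1
  else if h : ∃ k, 1 ≤ k ∧ IsCol k z.1 then
    ga h.choose z.1 |z.2 % (4 * abutLen h.choose) - 2 * abutLen h.choose|
  else 0

/-- The functions `gr` and `ga` agree at corners and roots, and have drift at least `c` and
increments at most `B k` on branches of order `k`. -/
structure IsPotential (β : ℝ) (gr : ℕ → ℤ → ℝ) (ga : ℕ → ℤ → ℤ → ℝ) (c : ℝ) (B : ℕ → ℝ) :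
    Prop where
  mono : Monotone B
  root_eq : ∀ k x, 1 ≤ k → IsCol k x → ga k x 0 = gr (k + 1) x
  corner_eq : ∀ k x, 1 ≤ k → IsCol k x → ga k x (abutLen k) = gr k x
  tip : ∀ k x, 1 ≤ k → RowOK k x → (bF k : ℤ) ∣ x → c ≤ gr k (x + 1) - gr k x
  plain : ∀ k x, 1 ≤ k → RowOK k x → ¬ (bF k : ℤ) ∣ x → ¬ (bF k : ℤ) ∣ x + 1 →
    ¬ (2 ≤ k ∧ IsCol (k - 1) x) →
    c * (β + 1) ≤ β * (gr k (x + 1) - gr k x) + (gr k (x - 1) - gr k x)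
  root : ∀ k x, 1 ≤ k → IsCol k x →
    c * (β + 3) ≤ β * (gr (k + 1) (x + 1) - gr (k + 1) x) + (gr (k + 1) (x - 1) - gr (k + 1) x) +
      2 * (ga k x 1 - ga k x 0)
  corner : ∀ k x, 1 ≤ k → IsCol k x →
    2 * c ≤ (gr k (x - 1) - gr k x) + (ga k x (abutLen k - 1) - ga k x (abutLen k))
  abut : ∀ k x s, 1 ≤ k → IsCol k x → 0 < s → s < abutLen k →
    2 * c ≤ (ga k x (s + 1) - ga k x s) + (ga k x (s - 1) - ga k x s)
  row_bound : ∀ k x, 1 ≤ k → RowOK k x → ¬ (bF k : ℤ) ∣ x + 1 → |gr k (x + 1) - gr k x| ≤ B k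
  abut_bound : ∀ k x s, 1 ≤ k → IsCol k x → 0 ≤ s → s < abutLen k →
    |ga k x (s + 1) - ga k x s| ≤ B k

/-- The vertices which the walk may occupy after `m` steps when it starts at abscissa `x₀`. -/
def Reachable (x₀ : ℤ) (m : ℕ) (z : V) : Prop :=
  z.1 ≤ x₀ + m ∧ ∃ k, 1 ≤ k ∧ (bF (k - 1) : ℤ) ≤ x₀ + m + 4 ∧ (IsRow k z ∨ IsAbut k z)

lemma glue_row {gr : ℕ → ℤ → ℝ} {ga : ℕ → ℤ → ℤ → ℝ} {k : ℕ} (hk : 1 ≤ k) {z : V}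
    (h : IsRow k z) : glue gr ga z = gr k z.1 := by
  have h' : ∃ k, 1 ≤ k ∧ IsRow k z := ⟨k, hk, h⟩
  rw [glue, dif_pos h', IsRow.unique h'.choose_spec.1 hk h'.choose_spec.2 h]

lemma IsCol.cases {k : ℕ} (hk : 1 ≤ k) {x y : ℤ} (h : IsCol k x)
    (h1 : abutLen k ≤ y % (4 * abutLen k)) (h2 : y % (4 * abutLen k) ≤ 3 * abutLen k) :
    (|y % (4 * abutLen k) - 2 * abutLen k| = abutLen k ∧ IsRow k (x, y)) ∨
      IsAbut k (x, y) ∨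
      (|y % (4 * abutLen k) - 2 * abutLen k| = 0 ∧ IsRow (k + 1) (x, y)) := by
  by_cases h3 : y % (4 * abutLen k) = abutLen k ∨ y % (4 * abutLen k) = 3 * abutLen k
  · refine Or.inl ⟨?_, exists_odd_of_emod h3, h.2⟩
    have := abutLen_pos k
    rcases h3 with h3 | h3 <;> rw [h3]
    · rw [abs_of_nonpos (by omega)]
      ring
    · rw [abs_of_nonneg (by omega)]
      ring
  by_cases h4 : y % (4 * abutLen k) = 2 * abutLen k
  · exact Or.inr (Or.inr ⟨by simp [h4], exists_odd_of_emod_succ hk h4, h.2.mono k.le_succ⟩)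
  · refine Or.inr (Or.inl ⟨h, ?_, ?_, h4⟩) <;> dsimp only <;> omega

lemma glue_col {β c : ℝ} {B : ℕ → ℝ} {gr : ℕ → ℤ → ℝ} {ga : ℕ → ℤ → ℤ → ℝ}
    (hp : IsPotential β gr ga c B) {k : ℕ} (hk : 1 ≤ k) {x y : ℤ} (h : IsCol k x)
    (h1 : abutLen k ≤ y % (4 * abutLen k)) (h2 : y % (4 * abutLen k) ≤ 3 * abutLen k) :
    glue gr ga (x, y) = ga k x |y % (4 * abutLen k) - 2 * abutLen k| := by
  rcases h.cases hk h1 h2 with ⟨h3, hr⟩ | ha | ⟨h3, hr⟩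
  · rw [h3, glue_row hk hr, hp.corner_eq k x hk h]
  · have h' : ∃ k, 1 ≤ k ∧ IsCol k ((x, y) : V).1 := ⟨k, hk, h⟩
    have hk' : h'.choose = k := h'.choose_spec.2.unique h
    rw [glue, dif_neg, dif_pos h', hk']
    rintro ⟨i, hi, ⟨l, hl, hy⟩, hr⟩
    exact ha.not_rowOK hk hi hl hy hr
  · rw [h3, glue_row (by omega) hr, hp.root_eq k x hk h]

lemma IsCol.reachable {x₀ : ℤ} {m k : ℕ} (hk : 1 ≤ k) {x y : ℤ} (h : IsCol k x)
    (h1 : abutLen k ≤ y % (4 * abutLen k)) (h2 : y % (4 * abutLen k) ≤ 3 * abutLen k)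
    (hx : x ≤ x₀ + m) : Reachable x₀ m (x, y) := by
  have hb : (bF k : ℤ) ≤ x₀ + m + 4 := by
    have := Int.le_of_dvd (by linarith [h.2.1]) h.1
    linarith
  have hb' : (bF (k - 1) : ℤ) ≤ x₀ + m + 4 :=
    (Int.le_of_dvd (by linarith [four_le_bF_int k]) (bF_dvd_bF (Nat.sub_le k 1))).trans hb
  rcases h.cases hk h1 h2 with ⟨-, hr⟩ | ha | ⟨-, hr⟩
  · exact ⟨hx, k, hk, hb', Or.inl hr⟩
  · exact ⟨hx, k, hk, hb', Or.inr ha⟩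
  · exact ⟨hx, k + 1, by omega, hb, Or.inl hr⟩

lemma IsRow.add_one {k : ℕ} {x y : ℤ} (h : IsRow k (x, y)) (hd : ¬ (bF k : ℤ) ∣ x + 1) :
    IsRow k (x + 1, y) := ⟨h.1, RowOK.add_one h.2 hd⟩

lemma IsRow.sub_one {k : ℕ} {x y : ℤ} (h : IsRow k (x, y)) (hd : ¬ (bF k : ℤ) ∣ x) :
    IsRow k (x - 1, y) := ⟨h.1, RowOK.sub_one h.2 hd⟩

lemma IsPotential.left_bound {β c : ℝ} {B : ℕ → ℝ} {gr : ℕ → ℤ → ℝ} {ga : ℕ → ℤ → ℤ → ℝ}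
    (hp : IsPotential β gr ga c B) {k : ℕ} (hk : 1 ≤ k) {x : ℤ} (h : RowOK k x)
    (hd : ¬ (bF k : ℤ) ∣ x) : |gr k (x - 1) - gr k x| ≤ B k := by
  have := hp.row_bound k (x - 1) hk (h.sub_one hd) (by rwa [sub_add_cancel])
  rwa [sub_add_cancel, abs_sub_comm] at this

lemma IsPotential.stepBound_row {β c : ℝ} (hβ : 0 < β) {B : ℕ → ℝ} {gr : ℕ → ℤ → ℝ}
    {ga : ℕ → ℤ → ℤ → ℝ} (hp : IsPotential β gr ga c B) {x₀ : ℤ} {m k : ℕ} (hk : 1 ≤ k) {x y : ℤ}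
    (h : IsRow k (x, y)) (hb : (bF (k - 1) : ℤ) ≤ x₀ + m + 4) (hx : x ≤ x₀ + m) :
    StepBound β xiEdges (Reachable x₀ (m + 1)) (glue gr ga) (x, y) c (B k) := by
  have hok : RowOK k x := h.2
  have hb1 : (bF (k - 1) : ℤ) ≤ x₀ + (m + 1 : ℕ) + 4 := by push_cast; linarith
  have hx1 : x + 1 ≤ x₀ + (m + 1 : ℕ) := by push_cast; linarith
  have hG := glue_row (gr := gr) (ga := ga) hk h
  by_cases hd : (bF k : ℤ) ∣ x + 1
  · have hd0 : ¬ (bF k : ℤ) ∣ x := not_dvd_of_dvd_succ hd k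
    have hc : IsCol k x := ⟨hd, hok⟩
    obtain ⟨y', hS, h1, h2, h3⟩ := h.neighbors_corner hk hd
    have hl := h.sub_one hd0
    have hGl := glue_row (gr := gr) (ga := ga) hk hl
    have hGv := glue_col hp hk hc h1 h2
    rw [h3] at hGv
    have hne : ((x - 1, y) : V) ∉ ({(x, y')} : Finset V) := by simp
    have hL := three_le_abutLen k
    refine stepBound_of_not_right (T := {(x - 1, y), (x, y')}) (by simp)
      (by simp only [Finset.mem_insert, Finset.mem_singleton, Prod.mk.injEq]; omega) hS ?_ ?_ ?_
    · simp only [Finset.mem_insert, Finset.mem_singleton, forall_eq_or_imp, forall_eq]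
      exact ⟨⟨by dsimp only; linarith, k, hk, hb1, Or.inl hl⟩, hc.reachable hk h1 h2 (by linarith)⟩
    · simp only [Finset.mem_insert, Finset.mem_singleton, forall_eq_or_imp, forall_eq]
      rw [hGl, hGv, hG]
      refine ⟨hp.left_bound hk hok hd0, ?_⟩
      have := hp.abut_bound k x (abutLen k - 1) hk hc (by omega) (by omega)
      rwa [sub_add_cancel, abs_sub_comm, hp.corner_eq k x hk hc] at this
    · rw [Finset.sum_insert hne, Finset.sum_singleton, Finset.card_insert_of_notMem hne,
        Finset.card_singleton, hGl, hGv, hG]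
      have := hp.corner k x hk hc
      rw [hp.corner_eq k x hk hc] at this
      push_cast
      linarith
  have hr := h.add_one hd
  have hGr := glue_row (gr := gr) (ga := ga) hk hr
  have hBr := hp.row_bound k x hk hok hd
  have hPr : Reachable x₀ (m + 1) (x + 1, y) := ⟨hx1, k, hk, hb1, Or.inl hr⟩
  by_cases hd0 : (bF k : ℤ) ∣ x
  · refine stepBound_of_right hβ (r := (x + 1, y)) (T := ∅) rfl (by simp)
      (h.neighbors_tip hk hd0) (by simpa using hPr) ?_ ?_
    · simpa [hGr, hG] using hBr
    · have := hp.tip k x hk hok hd0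
      rw [hGr, hG]
      simp only [Finset.card_empty, Finset.sum_empty, Nat.cast_zero, add_zero]
      rw [mul_comm]
      gcongr
  have hl := h.sub_one hd0
  have hGl := glue_row (gr := gr) (ga := ga) hk hl
  have hBl := hp.left_bound hk hok hd0
  have hPl : Reachable x₀ (m + 1) (x - 1, y) :=
    ⟨by dsimp only; linarith, k, hk, hb1, Or.inl hl⟩
  by_cases hc : 2 ≤ k ∧ IsCol (k - 1) x
  · obtain ⟨k, rfl⟩ : ∃ i, k = i + 1 := ⟨k - 1, by omega⟩
    obtain ⟨hk1, hc⟩ := hc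
    rw [Nat.add_sub_cancel] at hc
    have hk1 : 1 ≤ k := by omega
    have hL := three_le_abutLen k
    have h0 : y % (4 * abutLen k) = 2 * abutLen k := by
      obtain ⟨⟨l, hodd, rfl : y = _⟩, -⟩ := h
      exact emod_of_row_succ hk1 hodd
    have hu := emod_add_one (y := y) (q := 4 * abutLen k) (by omega) (by omega)
    have hv := emod_sub_one (y := y) (q := 4 * abutLen k) (by omega) (by omega)
    rw [h0] at hu hv
    have hGu := glue_col hp (y := y + 1) hk1 hc (by omega) (by omega)
    have hGv := glue_col hp (y := y - 1) hk1 hc (by omega) (by omega)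
    rw [hu, add_sub_cancel_left, abs_one] at hGu
    rw [hv, sub_right_comm, sub_self, zero_sub, abs_neg, abs_one] at hGv
    have hPu : Reachable x₀ (m + 1) (x, y + 1) := hc.reachable hk1 (by omega) (by omega)
      (by linarith)
    have hPv : Reachable x₀ (m + 1) (x, y - 1) := hc.reachable hk1 (by omega) (by omega)
      (by linarith)
    have hBv : |ga k x 1 - gr (k + 1) x| ≤ B (k + 1) := by
      have := hp.abut_bound k x 0 hk1 hc le_rfl (by omega)
      rw [zero_add, hp.root_eq k x hk1 hc] at this
      exact this.trans (hp.mono k.le_succ)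
    have hn1 : ((x, y + 1) : V) ∉ ({(x, y - 1)} : Finset V) := by
      simp only [Finset.mem_singleton, Prod.mk.injEq]
      omega
    have hn2 : ((x - 1, y) : V) ∉ ({(x, y + 1), (x, y - 1)} : Finset V) := by simp
    refine stepBound_of_right hβ (r := (x + 1, y)) (T := {(x - 1, y), (x, y + 1), (x, y - 1)}) rfl
      ?_ (h.neighbors_root hk1 hc) ?_ ?_ ?_
    · simp only [Finset.mem_insert, Finset.mem_singleton, Prod.mk.injEq]
      omega
    · simp only [Finset.mem_insert, Finset.mem_singleton, forall_eq_or_imp, forall_eq]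
      exact ⟨hPr, hPl, hPu, hPv⟩
    · simp only [Finset.mem_insert, Finset.mem_singleton, forall_eq_or_imp, forall_eq]
      rw [hGr, hGl, hGu, hGv, hG]
      exact ⟨hBr, hBl, hBv, hBv⟩
    · rw [Finset.sum_insert hn2, Finset.sum_insert hn1, Finset.sum_singleton,
        Finset.card_insert_of_notMem hn2, Finset.card_insert_of_notMem hn1,
        Finset.card_singleton, hGr, hGl, hGu, hGv, hG]
      have := hp.root k x hk1 hc
      rw [hp.root_eq k x hk1 hc] at this
      push_cast
      linarith
  · refine stepBound_of_right hβ (r := (x + 1, y)) (T := {(x - 1, y)}) rfl ?_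
      (h.neighbors_plain hk hd0 hd hc) ?_ ?_ ?_
    · simp only [Finset.mem_singleton, Prod.mk.injEq]
      omega
    · simp only [Finset.mem_insert, Finset.mem_singleton, forall_eq_or_imp, forall_eq]
      exact ⟨hPr, hPl⟩
    · simp only [Finset.mem_insert, Finset.mem_singleton, forall_eq_or_imp, forall_eq]
      rw [hGr, hGl, hG]
      exact ⟨hBr, hBl⟩
    · rw [Finset.sum_singleton, Finset.card_singleton, hGr, hGl, hG]
      simpa using hp.plain k x hk hok hd0 hd hc

lemma IsPotential.stepBound_abut {β c : ℝ} {B : ℕ → ℝ} {gr : ℕ → ℤ → ℝ}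
    {ga : ℕ → ℤ → ℤ → ℝ} (hp : IsPotential β gr ga c B) {x₀ : ℤ} {m k : ℕ} (hk : 1 ≤ k) {x y : ℤ}
    (h : IsAbut k (x, y)) (hx : x ≤ x₀ + m) :
    StepBound β xiEdges (Reachable x₀ (m + 1)) (glue gr ga) (x, y) c (B k) := by
  have hS := h.neighbors hk
  obtain ⟨hc, h1, h2, h3⟩ := h
  dsimp only at hc h1 h2 h3
  have hL := three_le_abutLen k
  have hu := emod_add_one (y := y) (q := 4 * abutLen k) (by omega) (by omega)
  have hv := emod_sub_one (y := y) (q := 4 * abutLen k) (by omega) (by omega)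
  have hG := glue_col hp hk hc h1.le h2.le
  have hGu := glue_col hp (y := y + 1) hk hc (by omega) (by omega)
  have hGv := glue_col hp (y := y - 1) hk hc (by omega) (by omega)
  have hx1 : x ≤ x₀ + (m + 1 : ℕ) := by push_cast; linarith
  have hPu : Reachable x₀ (m + 1) (x, y + 1) := hc.reachable hk (by omega) (by omega) hx1
  have hPv : Reachable x₀ (m + 1) (x, y - 1) := hc.reachable hk (by omega) (by omega) hx1
  rw [hu] at hGu
  rw [hv] at hGv
  set r := y % (4 * abutLen k)
  set s := |r - 2 * abutLen k| with hs
  obtain ⟨hs0, hsL, hcases⟩ : 0 < s ∧ s < abutLen k ∧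
      ((|r + 1 - 2 * abutLen k| = s + 1 ∧ |r - 1 - 2 * abutLen k| = s - 1) ∨
        (|r + 1 - 2 * abutLen k| = s - 1 ∧ |r - 1 - 2 * abutLen k| = s + 1)) := by
    rcases lt_or_gt_of_ne h3 with h3 | h3
    · rw [abs_of_neg (by omega)] at hs
      rw [abs_of_nonpos (by omega), abs_of_neg (by omega)]
      omega
    · rw [abs_of_pos (by omega)] at hs
      rw [abs_of_pos (by omega), abs_of_nonneg (by omega)]
      omega
  have hne : ((x, y + 1) : V) ∉ ({(x, y - 1)} : Finset V) := by
    simp only [Finset.mem_singleton, Prod.mk.injEq]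
    omega
  have hB1 := hp.abut_bound k x s hk hc hs0.le hsL
  have hB2 : |ga k x (s - 1) - ga k x s| ≤ B k := by
    have := hp.abut_bound k x (s - 1) hk hc (by omega) (by omega)
    rwa [sub_add_cancel, abs_sub_comm] at this
  have hdrift := hp.abut k x s hk hc hs0 hsL
  refine stepBound_of_not_right (T := {(x, y + 1), (x, y - 1)}) (by simp) (by simp) hS ?_ ?_ ?_
  · simp only [Finset.mem_insert, Finset.mem_singleton, forall_eq_or_imp, forall_eq]
    exact ⟨hPu, hPv⟩
  · simp only [Finset.mem_insert, Finset.mem_singleton, forall_eq_or_imp, forall_eq]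
    rw [hGu, hGv, hG]
    rcases hcases with ⟨e1, e2⟩ | ⟨e1, e2⟩ <;> rw [e1, e2]
    exacts [⟨hB1, hB2⟩, ⟨hB2, hB1⟩]
  · rw [Finset.sum_insert hne, Finset.sum_singleton, Finset.card_insert_of_notMem hne,
      Finset.card_singleton, hGu, hGv, hG]
    push_cast
    rcases hcases with ⟨e1, e2⟩ | ⟨e1, e2⟩ <;> rw [e1, e2] <;> linarith

lemma IsPotential.hasDrift {β c : ℝ} (hβ : 0 < β) {B : ℕ → ℝ} {gr : ℕ → ℤ → ℝ}
    {ga : ℕ → ℤ → ℤ → ℝ} (hp : IsPotential β gr ga c B) {x₀ : ℤ} {D : ℝ} (hD : 0 ≤ D)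
    (hB : ∀ k, 1 ≤ k → B k ^ 4 ≤ D * bF (k - 1)) :
    HasDrift β xiEdges (Reachable x₀) (glue gr ga) c D (x₀ + 4) := by
  rintro m ⟨x, y⟩ ⟨hx, k, hk, hb, h⟩
  have key : StepBound β xiEdges (Reachable x₀ (m + 1)) (glue gr ga) (x, y) c (B k) := by
    rcases h with h | h
    · exact hp.stepBound_row hβ hk h hb hx
    · exact hp.stepBound_abut hk h hx
  obtain ⟨S, h1, h2, h3, h4, h5⟩ := key
  refine ⟨S, h1, h2, h3, h4, fun w hw => ?_⟩
  have hb' : (bF (k - 1) : ℝ) ≤ x₀ + m + 4 := by exact_mod_cast hb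
  calc (glue gr ga w - glue gr ga (x, y)) ^ 4 = |glue gr ga w - glue gr ga (x, y)| ^ 4 :=
        (Even.pow_abs (by decide) _).symm
    _ ≤ B k ^ 4 := by gcongr; exact h5 w hw
    _ ≤ D * bF (k - 1) := hB k hk
    _ ≤ D * (m + (x₀ + 4)) := by gcongr; linarith

/-! ### A family of potentials -/

/-- A `b`-periodic perturbation of drift `-(β - 1) / b` away from the points `x` with
`b ∣ x + 1`, and of positive drift at these points. -/
def perturb (β : ℝ) (b : ℕ) (x : ℤ) : ℝ :=
  (1 - β⁻¹ ^ ((x + 1) % b).toNat) / (1 - β⁻¹ ^ b) - ((x + 1) % b : ℤ) / (b : ℝ)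

section perturb

variable {β : ℝ} {b : ℕ} {x : ℤ}

lemma perturb_of_dvd (h : (b : ℤ) ∣ x + 1) : perturb β b x = 0 := by
  simp [perturb, Int.emod_eq_zero_of_dvd h]

lemma one_sub_inv_pow_pos (hβ : 1 < β) (hb : 2 ≤ b) : 0 < 1 - β⁻¹ ^ b := by
  have := pow_lt_one₀ (inv_nonneg.2 (zero_le_one.trans hβ.le)) (inv_lt_one_of_one_lt₀ hβ)
    (by omega : b ≠ 0)
  linarith

lemma abs_perturb_le_one (hβ : 1 < β) (hb : 2 ≤ b) : |perturb β b x| ≤ 1 := by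
  have hd := one_sub_inv_pow_pos hβ hb
  have hq : 0 ≤ β⁻¹ := inv_nonneg.2 (zero_le_one.trans hβ.le)
  have hq1 : β⁻¹ ≤ 1 := inv_le_one_of_one_le₀ hβ.le
  have h0 := Int.emod_nonneg (x + 1) (b := b) (by omega)
  have h1 := Int.emod_lt_of_pos (x + 1) (b := b) (by omega)
  have hb' : (0 : ℝ) < b := by positivity
  have h2 : 0 ≤ (((x + 1) % b : ℤ) : ℝ) / b := by
    have : (0 : ℝ) ≤ ((x + 1) % b : ℤ) := by exact_mod_cast h0
    positivity
  have h3 : (((x + 1) % b : ℤ) : ℝ) / b ≤ 1 := by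
    rw [div_le_one hb']
    exact_mod_cast h1.le
  have h4 : 0 ≤ (1 - β⁻¹ ^ ((x + 1) % b).toNat) / (1 - β⁻¹ ^ b) :=
    div_nonneg (sub_nonneg.2 (pow_le_one₀ hq hq1)) hd.le
  have h5 : (1 - β⁻¹ ^ ((x + 1) % b).toNat) / (1 - β⁻¹ ^ b) ≤ 1 := by
    rw [div_le_one hd]
    have := pow_le_pow_of_le_one hq hq1 (show ((x + 1) % b).toNat ≤ b by omega)
    linarith
  rw [perturb, abs_le]
  constructor <;> linarith

lemma perturb_add_one_sub (hβ : 1 < β) (hb : 2 ≤ b) : perturb β b (x + 1) - perturb β b x =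
    (1 - β⁻¹) / (1 - β⁻¹ ^ b) * β⁻¹ ^ ((x + 1) % b).toNat - 1 / b := by
  have hd := one_sub_inv_pow_pos hβ hb
  have hb' : (0 : ℝ) < b := by positivity
  have h0 := Int.emod_nonneg (x + 1) (b := b) (by omega)
  by_cases h : (b : ℤ) ∣ x + 1 + 1
  · obtain ⟨m, hm⟩ := h
    have h1 : (x + 1) % b = b - 1 :=
      emod_eq_of_eq (m := m - 1) (by linarith) (by omega) (by omega)
    rw [perturb_of_dvd ⟨m, hm⟩, perturb, h1]
    obtain ⟨n, rfl⟩ : ∃ n, b = n + 1 := ⟨b - 1, by omega⟩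
    have h2 : (((n + 1 : ℕ) : ℤ) - 1).toNat = n := by omega
    rw [h2]
    generalize β⁻¹ = q at hd ⊢
    push_cast at hb' ⊢
    field_simp
    ring
  · have h1 := succ_emod_of_not_dvd (by omega) h
    rw [perturb, perturb, h1, show ((x + 1) % b + 1).toNat = ((x + 1) % b).toNat + 1 by omega]
    push_cast
    ring

lemma perturb_step_bounds (hβ : 1 < β) (hb : 2 ≤ b) :
    -(1 / b) ≤ perturb β b (x + 1) - perturb β b x ∧
      perturb β b (x + 1) - perturb β b x ≤ 1 := by
  have hd := one_sub_inv_pow_pos hβ hb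
  have hq : 0 ≤ β⁻¹ := inv_nonneg.2 (zero_le_one.trans hβ.le)
  have hq1 : β⁻¹ ≤ 1 := inv_le_one_of_one_le₀ hβ.le
  rw [perturb_add_one_sub hβ hb]
  have h1 : 0 ≤ (1 - β⁻¹) / (1 - β⁻¹ ^ b) := div_nonneg (by linarith) hd.le
  have h2 : (1 - β⁻¹) / (1 - β⁻¹ ^ b) ≤ 1 := by
    rw [div_le_one hd]
    have := pow_le_of_le_one hq hq1 (by omega : b ≠ 0)
    linarith
  have h3 : 0 ≤ β⁻¹ ^ ((x + 1) % b).toNat := by positivity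
  have h4 : β⁻¹ ^ ((x + 1) % b).toNat ≤ 1 := pow_le_one₀ hq hq1
  have h5 : (0 : ℝ) ≤ 1 / b := by positivity
  constructor
  · have := mul_nonneg h1 h3
    linarith
  · have := mul_le_one₀ h2 h3 h4
    linarith

lemma perturb_drift (hβ : 1 < β) (hb : 2 ≤ b) (h : ¬ (b : ℤ) ∣ x + 1) :
    β * (perturb β b (x + 1) - perturb β b x) + (perturb β b (x - 1) - perturb β b x) =
      -((β - 1) / b) := by
  have h1 := perturb_add_one_sub (x := x) hβ hb
  have h2 := perturb_add_one_sub (x := x - 1) hβ hb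
  rw [sub_add_cancel] at h2
  have h0 := Int.emod_nonneg x (b := b) (by omega)
  have h3 := succ_emod_of_not_dvd (by omega) h
  rw [h1, ← neg_sub (perturb β b x), h2, h3,
    show (x % b + 1).toNat = (x % b).toNat + 1 by omega, pow_succ]
  field_simp
  ring

lemma perturb_drift_of_dvd (hβ : 1 < β) (hb : 2 ≤ b) (h : (b : ℤ) ∣ x + 1) :
    β * (perturb β b (x + 1) - perturb β b x) + (perturb β b (x - 1) - perturb β b x) =
      (β - 1) * (1 - 1 / b) := by
  have h1 := perturb_add_one_sub (x := x) hβ hb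
  have h2 := perturb_add_one_sub (x := x - 1) hβ hb
  rw [sub_add_cancel] at h2
  have hd := one_sub_inv_pow_pos hβ hb
  obtain ⟨m, hm⟩ := h
  have h3 : x % b = b - 1 :=
    emod_eq_of_eq (m := m - 1) (by linarith) (by omega) (by omega)
  rw [h1, ← neg_sub (perturb β b x), h2, h3, hm, Int.mul_emod_right]
  obtain ⟨n, rfl⟩ : ∃ n, b = n + 1 := ⟨b - 1, by omega⟩
  have h4 : (((n + 1 : ℕ) : ℤ) - 1).toNat = n := by omega
  rw [h4, Int.toNat_zero, pow_zero]
  have hβ0 : β ≠ 0 := by linarith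
  have hb' : ((n : ℝ) + 1) ≠ 0 := by positivity
  have h5 : 1 - β⁻¹ ^ n * β⁻¹ ≠ 0 := by rw [← pow_succ]; exact hd.ne'
  have h6 : β * ((1 - β⁻¹) / (1 - β⁻¹ ^ n * β⁻¹) * 1) - (1 - β⁻¹) / (1 - β⁻¹ ^ n * β⁻¹) * β⁻¹ ^ n =
      β - 1 := by
    rw [div_mul_eq_mul_div, div_mul_eq_mul_div, mul_div_assoc', ← sub_div, div_eq_iff h5]
    field_simp
  rw [pow_succ]
  push_cast
  linear_combination h6

lemma perturb_left_nonpos (hβ : 1 < β) (hb : 2 ≤ b) (h : (b : ℤ) ∣ x + 1) :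
    perturb β b x - perturb β b (x - 1) ≤ 0 := by
  have h2 := perturb_add_one_sub (x := x - 1) hβ hb
  rw [sub_add_cancel] at h2
  have hd := one_sub_inv_pow_pos hβ hb
  have hq : 0 ≤ β⁻¹ := inv_nonneg.2 (zero_le_one.trans hβ.le)
  have hq1 : β⁻¹ ≤ 1 := inv_le_one_of_one_le₀ hβ.le
  obtain ⟨m, hm⟩ := h
  have h3 : x % b = b - 1 :=
    emod_eq_of_eq (m := m - 1) (by linarith) (by omega) (by omega)
  have hb' : (0 : ℝ) < b := by positivity
  have h4 : ((b : ℤ) - 1).toNat = b - 1 := by omega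
  rw [h2, h3, h4, sub_nonpos, div_mul_eq_mul_div, div_le_div_iff₀ hd hb', one_mul,
    ← mul_neg_geom_sum, mul_assoc]
  refine mul_le_mul_of_nonneg_left ?_ (by linarith)
  calc β⁻¹ ^ (b - 1) * b = ∑ _i ∈ Finset.range b, β⁻¹ ^ (b - 1) := by simp [mul_comm]
    _ ≤ _ := Finset.sum_le_sum fun i hi =>
      pow_le_pow_of_le_one hq hq1 (by have := Finset.mem_range.1 hi; omega)

lemma perturb_right_ge (hβ : 1 < β) (hb : 2 ≤ b) (h : (b : ℤ) ∣ x) :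
    (1 - β⁻¹) * β⁻¹ - 1 / b ≤ perturb β b (x + 1) - perturb β b x := by
  have hd := one_sub_inv_pow_pos hβ hb
  have hq : 0 ≤ β⁻¹ := inv_nonneg.2 (zero_le_one.trans hβ.le)
  have hq1 : β⁻¹ ≤ 1 := inv_le_one_of_one_le₀ hβ.le
  obtain ⟨m, hm⟩ := h
  have h3 : (x + 1) % b = 1 := emod_eq_of_eq (m := m) (by linarith) (by omega) (by omega)
  rw [perturb_add_one_sub hβ hb, h3, Int.toNat_one, pow_one]
  gcongr
  rw [le_div_iff₀ hd]
  have : 0 ≤ β⁻¹ ^ b := by positivity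
  nlinarith

end perturb

/-- The value on the rows of order `k` of the potential with slope `g k` there. -/
def rowPot (β a : ℝ) (K : ℕ) (g A τ : ℕ → ℝ) (k : ℕ) (x : ℤ) : ℝ :=
  a * x + ∑ i ∈ Finset.Ico k (K + 1), (g (i + 1) - g i) * (bF i - 1 - (x % bF i : ℤ)) +
    A k * perturb β (bF (k - 1)) x + ∑ i ∈ Finset.range k, abutLen i * τ i

/-- The value on the abutments of order `k` of the same potential. -/
def abutPot (β a : ℝ) (K : ℕ) (g A τ : ℕ → ℝ) (w : ℝ) (k : ℕ) (x s : ℤ) : ℝ :=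
  rowPot β a K g A τ (k + 1) x - s * τ k - w * (s * (abutLen k - s))

lemma two_le_bF (k : ℕ) : 2 ≤ bF k := by linarith [four_le_bF k]

lemma rowPot_add_one_sub (β a : ℝ) (K : ℕ) (g A τ : ℕ → ℝ) (hg : ∀ k, K < k → g k = a) {k : ℕ}
    {x : ℤ} (hd : ¬ (bF k : ℤ) ∣ x + 1) :
    rowPot β a K g A τ k (x + 1) - rowPot β a K g A τ k x =
      g k + A k * (perturb β (bF (k - 1)) (x + 1) - perturb β (bF (k - 1)) x) := by
  have h1 : ∑ i ∈ Finset.Ico k (K + 1), (g (i + 1) - g i) * (bF i - 1 - ((x + 1) % bF i : ℤ)) =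
      ∑ i ∈ Finset.Ico k (K + 1), (g (i + 1) - g i) * (bF i - 1 - (x % bF i : ℤ)) -
        ∑ i ∈ Finset.Ico k (K + 1), (g (i + 1) - g i) := by
    rw [← Finset.sum_sub_distrib]
    refine Finset.sum_congr rfl fun i hi => ?_
    rw [succ_emod_of_not_dvd (by linarith [four_le_bF_int i])
      fun h => hd ((bF_dvd_bF (Finset.mem_Ico.1 hi).1).trans h)]
    push_cast
    ring
  have h2 : ∑ i ∈ Finset.Ico k (K + 1), (g (i + 1) - g i) = a - g k := by
    rcases le_or_gt k (K + 1) with h | h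
    · rw [Finset.sum_Ico_sub g h, hg (K + 1) (Nat.lt_succ_self K)]
    · rw [Finset.Ico_eq_empty (by omega), Finset.sum_empty, hg k (by omega), sub_self]
  rw [rowPot, rowPot, h1, h2]
  push_cast
  ring

lemma rowPot_succ (β a : ℝ) (K : ℕ) (g A τ : ℕ → ℝ) {k : ℕ} {x : ℤ} (hd : (bF k : ℤ) ∣ x + 1) :
    rowPot β a K g A τ (k + 1) x = rowPot β a K g A τ k x + abutLen k * τ k := by
  have h1 : ∑ i ∈ Finset.Ico k (K + 1), (g (i + 1) - g i) * (bF i - 1 - (x % bF i : ℤ)) =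
      ∑ i ∈ Finset.Ico (k + 1) (K + 1), (g (i + 1) - g i) * (bF i - 1 - (x % bF i : ℤ)) := by
    rcases lt_or_ge k (K + 1) with h | h
    · obtain ⟨m, hm⟩ := hd
      have h3 : x % bF k = bF k - 1 := emod_eq_of_eq (m := m - 1) (by linarith)
        (by linarith [four_le_bF_int k]) (by linarith)
      rw [Finset.sum_eq_sum_Ico_succ_bot h, h3]
      simp
    · rw [Finset.Ico_eq_empty (by omega), Finset.Ico_eq_empty (by omega)]
  rw [rowPot, rowPot, h1, Nat.add_sub_cancel, perturb_of_dvd hd,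
    perturb_of_dvd ((bF_dvd_bF (Nat.sub_le k 1)).trans hd), Finset.sum_range_succ]
  ring

lemma isPotential_rowPot {β : ℝ} (hβ : 1 < β) {a c w : ℝ} {K : ℕ} {g A τ B : ℕ → ℝ}
    (hg : ∀ k, K < k → g k = a) (hB : Monotone B)
    (htip : ∀ k, 1 ≤ k → ∀ e : ℝ, (1 - β⁻¹) * β⁻¹ - 1 / bF (k - 1) ≤ e → c ≤ g k + A k * e)
    (hplain : ∀ k, 1 ≤ k → c * (β + 1) ≤ (β - 1) * g k - A k * ((β - 1) / bF (k - 1)))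
    (hroot : ∀ k, 1 ≤ k → c * (β + 3) ≤ (β - 1) * (g (k + 1) + A (k + 1) * (1 - 1 / bF k)) -
      2 * (τ k + w * (abutLen k - 1)))
    (hcorner : ∀ k, 1 ≤ k → ∀ e ≤ 0, 2 * c ≤ -(g k + A k * e) + (τ k - w * (abutLen k - 1)))
    (hw : c ≤ w) (hB1 : ∀ k, 1 ≤ k → |g k| + |A k| ≤ B k)
    (hB2 : ∀ k, 1 ≤ k → |τ k| + |w| * abutLen k ≤ B k) :
    IsPotential β (rowPot β a K g A τ) (abutPot β a K g A τ w) c B where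
  mono := hB
  root_eq k x _ _ := by simp [abutPot]
  corner_eq k x _ h := by
    rw [abutPot, rowPot_succ _ _ _ _ _ _ h.1]
    ring
  tip k x hk _ hd := by
    rw [rowPot_add_one_sub _ _ _ _ _ _ hg fun h => not_dvd_of_dvd_succ h k hd]
    exact htip k hk _ (perturb_right_ge hβ (two_le_bF _) ((bF_dvd_bF (Nat.sub_le k 1)).trans hd))
  plain k x hk hr hd0 hd hc := by
    have h1 := rowPot_add_one_sub β a K g A τ hg hd
    have h2 := rowPot_add_one_sub β a K g A τ hg (x := x - 1) (by rwa [sub_add_cancel])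
    rw [sub_add_cancel] at h2
    have hnd : ¬ (bF (k - 1) : ℤ) ∣ x + 1 := by
      intro h
      rcases hk.eq_or_lt with rfl | hk2
      · exact hd h
      · refine hc ⟨hk2, h, hr.1, fun i hi => ?_⟩
        rcases hi.eq_or_lt with rfl | hi
        · rintro ⟨n, hn⟩
          obtain ⟨m, hm⟩ := h
          have hb := four_le_bF_int (k - 1)
          rw [ediv_eq_of_eq (m := m - 1) (r := bF (k - 1) - 1) (q := bF (k - 1)) (by linarith)
            (by omega) (by omega), sub_add_cancel] at hn
          refine hd ⟨n, ?_⟩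
          have h3 := bF_succ (k - 1)
          rw [Nat.sub_add_cancel hk] at h3
          rw [hm, hn, h3]
          push_cast
          ring
        · exact hr.2 i (by omega)
    have h3 := perturb_drift hβ (two_le_bF (k - 1)) hnd
    have h4 := hplain k hk
    have h5 : β * (rowPot β a K g A τ k (x + 1) - rowPot β a K g A τ k x) +
        (rowPot β a K g A τ k (x - 1) - rowPot β a K g A τ k x) =
        (β - 1) * g k - A k * ((β - 1) / bF (k - 1)) := by
      linear_combination β * h1 - h2 + A k * h3
    rwa [h5]
  root k x hk hc := by
    have hd : ¬ (bF (k + 1) : ℤ) ∣ x + 1 := hc.2.not_dvd (Nat.lt_succ_self k)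
    have hd' : ¬ (bF (k + 1) : ℤ) ∣ x := not_dvd_of_dvd_succ hc.1 _
    have h1 := rowPot_add_one_sub β a K g A τ hg hd
    have h2 := rowPot_add_one_sub β a K g A τ hg (x := x - 1) (by rwa [sub_add_cancel])
    rw [sub_add_cancel] at h2
    rw [Nat.add_sub_cancel] at h1 h2
    have h3 := perturb_drift_of_dvd hβ (two_le_bF k) hc.1
    have h4 := hroot k hk
    have h5 : β * (rowPot β a K g A τ (k + 1) (x + 1) - rowPot β a K g A τ (k + 1) x) +
        (rowPot β a K g A τ (k + 1) (x - 1) - rowPot β a K g A τ (k + 1) x) +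
          2 * (abutPot β a K g A τ w k x 1 - abutPot β a K g A τ w k x 0) =
        (β - 1) * (g (k + 1) + A (k + 1) * (1 - 1 / bF k)) -
          2 * (τ k + w * (abutLen k - 1)) := by
      rw [abutPot, abutPot]
      push_cast
      linear_combination β * h1 - h2 + A (k + 1) * h3
    rwa [h5]
  corner k x hk hc := by
    have hd' : ¬ (bF k : ℤ) ∣ x := not_dvd_of_dvd_succ hc.1 _
    have h2 := rowPot_add_one_sub β a K g A τ hg (x := x - 1) (by rwa [sub_add_cancel])
    rw [sub_add_cancel] at h2
    have h3 := hcorner k hk _ (perturb_left_nonpos hβ (two_le_bF (k - 1))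
      ((bF_dvd_bF (Nat.sub_le k 1)).trans hc.1))
    rw [← h2] at h3
    rw [abutPot, abutPot]
    push_cast
    linarith
  abut k x s _ _ _ _ := by
    rw [abutPot, abutPot, abutPot]
    push_cast
    linarith
  row_bound k x hk _ hd := by
    rw [rowPot_add_one_sub _ _ _ _ _ _ hg hd]
    refine (abs_add_le _ _).trans (le_trans ?_ (hB1 k hk))
    rw [abs_mul]
    gcongr
    refine mul_le_of_le_one_right (abs_nonneg _) ?_
    obtain ⟨h1, h2⟩ := perturb_step_bounds (x := x) hβ (two_le_bF (k - 1))
    have h3 : (1 : ℝ) / bF (k - 1) ≤ 1 := by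
      have : (1 : ℝ) ≤ bF (k - 1) := by exact_mod_cast (by linarith [four_le_bF (k - 1)])
      rw [div_le_one (by linarith)]
      exact this
    exact abs_le.2 ⟨by linarith, h2⟩
  abut_bound k x s hk _ hs hsL := by
    have h1 : abutPot β a K g A τ w k x (s + 1) - abutPot β a K g A τ w k x s =
        -τ k - w * (abutLen k - 2 * s - 1) := by
      rw [abutPot, abutPot]
      push_cast
      ring
    rw [h1]
    refine (abs_sub _ _).trans (le_trans ?_ (hB2 k hk))
    rw [abs_neg, abs_mul]
    gcongr
    have h2 : (0 : ℝ) ≤ s := by exact_mod_cast hs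
    have h3 : (s : ℝ) + 1 ≤ abutLen k := by exact_mod_cast hsL
    exact abs_le.2 ⟨by linarith, by linarith⟩

/-! ### Growth of potentials -/

/-- Geometric sequences are negligible with respect to `bF (k - 1)`. -/
lemma exists_pow_four_le_bF (M c : ℝ) : ∃ D : ℝ, 1 ≤ D ∧
    ∀ k, 1 ≤ k → (M * c ^ k) ^ 4 ≤ D * bF (k - 1) := by
  obtain ⟨N, hN⟩ := pow_unbounded_of_one_lt (c ^ 4) (by norm_num : (1 : ℝ) < 3)
  have hE1 : (1 : ℝ) ≤ 3 ^ N := one_le_pow₀ (by norm_num)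
  have key : ∀ k : ℕ, ((3 : ℝ) ^ N) ^ (k + 1) ≤ (3 ^ N) ^ (N + 1) * bF k := by
    intro k
    rcases le_or_gt k N with h | h
    · have h1 : (1 : ℝ) ≤ bF k := by exact_mod_cast (by linarith [four_le_bF k])
      exact (pow_le_pow_right₀ hE1 (by omega)).trans (le_mul_of_one_le_right (by positivity) h1)
    · induction k with
      | zero => omega
      | succ k ih =>
        have ih' : ((3 : ℝ) ^ N) ^ (k + 1) ≤ (3 ^ N) ^ (N + 1) * bF k := by
          rcases (Nat.le_of_lt_succ h).eq_or_lt with h' | h'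
          · have h1 : (1 : ℝ) ≤ bF k := by exact_mod_cast (by linarith [four_le_bF k])
            exact (pow_le_pow_right₀ hE1 (by omega)).trans
              (le_mul_of_one_le_right (by positivity) h1)
          · exact ih h'
        rw [pow_succ, bF_succ]
        push_cast
        have h2 : (3 : ℝ) ^ N ≤ 3 ^ k := pow_le_pow_right₀ (by norm_num) (by omega)
        calc ((3 : ℝ) ^ N) ^ (k + 1) * 3 ^ N ≤ ((3 ^ N) ^ (N + 1) * bF k) * 3 ^ k := by gcongr
          _ = _ := by ring
  refine ⟨1 + M ^ 4 * (3 ^ N) ^ (N + 1), ?_, fun k hk => ?_⟩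
  · have : 0 ≤ M ^ 4 * ((3 : ℝ) ^ N) ^ (N + 1) := by positivity
    linarith
  · have h1 := key (k - 1)
    rw [Nat.sub_add_cancel hk] at h1
    calc (M * c ^ k) ^ 4 = M ^ 4 * (c ^ 4) ^ k := by ring
      _ ≤ M ^ 4 * (3 ^ N) ^ k := by gcongr
      _ ≤ M ^ 4 * ((3 ^ N) ^ (N + 1) * bF (k - 1)) := by gcongr
      _ ≤ _ := by
        have : (0 : ℝ) ≤ bF (k - 1) := by positivity
        linarith

lemma exists_forall_pow_le_bF {M c : ℝ} (hM : 0 ≤ M) (hc : 1 < c) {ε : ℝ} (hε : 0 < ε) :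
    ∃ K : ℕ, ∀ k, K < k → M * c ^ k / bF (k - 1) ≤ ε := by
  obtain ⟨D, hD, h⟩ := exists_pow_four_le_bF 1 c
  obtain ⟨K, hK⟩ := pow_unbounded_of_one_lt (M * D / ε) hc
  refine ⟨K, fun k hk => ?_⟩
  have hb : (0 : ℝ) < bF (k - 1) := by exact_mod_cast (by linarith [four_le_bF (k - 1)])
  have hck : 1 ≤ c ^ k := one_le_pow₀ hc.le
  have h1 := h k (by omega)
  rw [one_mul] at h1
  have h2 : M * D / ε ≤ c ^ k := hK.le.trans (pow_le_pow_right₀ hc.le hk.le)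
  rw [div_le_iff₀ hε] at h2
  rw [div_le_iff₀ hb]
  have h3 : c ^ k * c ^ k ≤ (c ^ k) ^ 4 := by
    rw [← sq]
    exact pow_le_pow_right₀ hck (by norm_num)
  have h4 : M * c ^ k * c ^ k ≤ ε * bF (k - 1) * c ^ k := by
    calc M * c ^ k * c ^ k = M * (c ^ k * c ^ k) := by ring
      _ ≤ M * (D * bF (k - 1)) :=
        mul_le_mul_of_nonneg_left (h3.trans h1) hM
      _ = M * D * bF (k - 1) := by ring
      _ ≤ c ^ k * ε * bF (k - 1) := by gcongr
      _ = _ := by ring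
  exact le_of_mul_le_mul_right h4 (by linarith)

lemma abutLen_le_pow {c : ℝ} (hc : 2 ≤ c) (k : ℕ) : (abutLen k : ℝ) ≤ 3 * c ^ k := by
  have h1 : ((2 : ℝ)) ^ (k - 1) ≤ c ^ k :=
    (pow_le_pow_right₀ (by norm_num) (Nat.sub_le k 1)).trans (by gcongr)
  rw [abutLen]
  push_cast
  linarith

lemma sum_pow_le {y : ℝ} (hy : 2 ≤ y) (k : ℕ) : ∑ i ∈ Finset.range k, y ^ i ≤ y ^ k := by
  induction k with
  | zero => simp
  | succ k ih =>
    rw [Finset.sum_range_succ, pow_succ]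
    have : 0 < y ^ k := by positivity
    nlinarith

lemma abs_rowPot_sub_le {β : ℝ} (hβ : 1 < β) {M c a : ℝ} (hc : 2 ≤ c) {K : ℕ} {g A τ : ℕ → ℝ}
    (hA : ∀ k, |A k| ≤ M * c ^ k) (hτ : ∀ k, |τ k| ≤ M * c ^ k) (k : ℕ) (x : ℤ) :
    |rowPot β a K g A τ k x - a * x| ≤
      ∑ i ∈ Finset.range (K + 1), |g (i + 1) - g i| * bF i + M * c ^ k + 3 * M * (c ^ 2) ^ k := by
  have hM : 0 ≤ M := by simpa using (abs_nonneg _).trans (hA 0)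
  have h1 : |∑ i ∈ Finset.Ico k (K + 1), (g (i + 1) - g i) * (bF i - 1 - (x % bF i : ℤ))| ≤
      ∑ i ∈ Finset.range (K + 1), |g (i + 1) - g i| * bF i := by
    refine (Finset.abs_sum_le_sum_abs _ _).trans ?_
    refine (Finset.sum_le_sum_of_subset_of_nonneg (fun i hi => ?_)
      fun _ _ _ => abs_nonneg _).trans (Finset.sum_le_sum fun i _ => ?_)
    · simp only [Finset.mem_Ico, Finset.mem_range] at hi ⊢
      omega
    · rw [abs_mul]
      gcongr
      obtain ⟨h2, h3⟩ := bF_emod_lt i x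
      have h2' : (0 : ℝ) ≤ (x % bF i : ℤ) := by exact_mod_cast h2
      have h3' : ((x % bF i : ℤ) : ℝ) + 1 ≤ bF i := by exact_mod_cast h3
      exact abs_le.2 ⟨by linarith, by linarith⟩
  have h2 : |A k * perturb β (bF (k - 1)) x| ≤ M * c ^ k := by
    rw [abs_mul]
    exact (mul_le_of_le_one_right (abs_nonneg _) (abs_perturb_le_one hβ (two_le_bF _))).trans (hA k)
  have h3 : |∑ i ∈ Finset.range k, abutLen i * τ i| ≤ 3 * M * (c ^ 2) ^ k := by
    calc |∑ i ∈ Finset.range k, abutLen i * τ i| ≤ ∑ i ∈ Finset.range k, |abutLen i * τ i| :=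
          Finset.abs_sum_le_sum_abs _ _
      _ ≤ ∑ i ∈ Finset.range k, 3 * M * (c ^ 2) ^ i := by
        refine Finset.sum_le_sum fun i _ => ?_
        have hL : (0 : ℝ) ≤ abutLen i := by exact_mod_cast (abutLen_pos i).le
        rw [abs_mul, abs_of_nonneg hL]
        calc abutLen i * |τ i| ≤ (3 * c ^ i) * (M * c ^ i) :=
              mul_le_mul (abutLen_le_pow hc i) (hτ i) (abs_nonneg _) (by positivity)
          _ = _ := by ring
      _ = 3 * M * ∑ i ∈ Finset.range k, (c ^ 2) ^ i := by rw [Finset.mul_sum]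
      _ ≤ _ := by gcongr; exact sum_pow_le (by nlinarith) k
  have h4 : rowPot β a K g A τ k x - a * x =
      ∑ i ∈ Finset.Ico k (K + 1), (g (i + 1) - g i) * (bF i - 1 - (x % bF i : ℤ)) +
        A k * perturb β (bF (k - 1)) x + ∑ i ∈ Finset.range k, abutLen i * τ i := by
    rw [rowPot]
    ring
  rw [h4]
  exact (abs_add_three _ _ _).trans (by linarith)

/-- `gr` and `ga` are within `B k` of `a * x` on branches of order `k`. -/
def IsClose (a : ℝ) (gr : ℕ → ℤ → ℝ) (ga : ℕ → ℤ → ℤ → ℝ) (B : ℕ → ℝ) : Prop :=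
  (∀ k x, |gr k x - a * x| ≤ B k) ∧
    ∀ k x s, 0 ≤ s → s ≤ abutLen k → |ga k x s - a * x| ≤ B k

lemma exists_bound {β : ℝ} (hβ : 1 < β) {M c a w : ℝ} (hc : 2 ≤ c) {K : ℕ} {g A τ : ℕ → ℝ}
    (hg : ∀ k, |g k| ≤ M * c ^ k) (hA : ∀ k, |A k| ≤ M * c ^ k) (hτ : ∀ k, |τ k| ≤ M * c ^ k)
    (hw : |w| ≤ M) : ∃ N : ℝ, Monotone (fun k : ℕ => N * (c ^ 2) ^ k) ∧
      (∀ k, |g k| + |A k| ≤ N * (c ^ 2) ^ k) ∧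
      (∀ k, |τ k| + |w| * abutLen k ≤ N * (c ^ 2) ^ k) ∧
      IsClose a (rowPot β a K g A τ) (abutPot β a K g A τ w) fun k => N * (c ^ 2) ^ k := by
  have hM : 0 ≤ M := (abs_nonneg _).trans hw
  set C₀ := ∑ i ∈ Finset.range (K + 1), |g (i + 1) - g i| * bF i with hC₀
  have hC₀' : 0 ≤ C₀ := Finset.sum_nonneg fun i _ => by positivity
  have hc2 : 1 ≤ c ^ 2 := by nlinarith
  have hp : ∀ k : ℕ, 1 ≤ (c ^ 2) ^ k := fun k => one_le_pow₀ hc2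
  have hcp : ∀ k : ℕ, c ^ k ≤ (c ^ 2) ^ k := fun k => by gcongr; nlinarith
  have hMc : ∀ k : ℕ, M * c ^ k ≤ M * (c ^ 2) ^ k := fun k =>
    mul_le_mul_of_nonneg_left (hcp k) hM
  have hMC : M ≤ M * c ^ 2 := le_mul_of_one_le_right hM hc2
  have hCp : ∀ k : ℕ, C₀ ≤ C₀ * (c ^ 2) ^ k := fun k => le_mul_of_one_le_right hC₀' (hp k)
  have hMp : ∀ k : ℕ, 0 ≤ M * (c ^ 2) ^ k := fun k => by positivity
  have hMp2 : ∀ k : ℕ, M * (c ^ 2) ^ k ≤ M * c ^ 2 * (c ^ 2) ^ k := fun k => by gcongr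
  have hL : ∀ k, |w| * abutLen k ≤ 3 * (M * (c ^ 2) ^ k) := fun k => by
    calc |w| * abutLen k ≤ M * (3 * c ^ k) :=
          mul_le_mul hw (abutLen_le_pow hc k) (by exact_mod_cast (abutLen_pos k).le) hM
      _ ≤ _ := by linarith [hMc k]
  have hrow := fun k x => abs_rowPot_sub_le (a := a) (K := K) (g := g) hβ hc hA hτ k x
  rw [← hC₀] at hrow
  refine ⟨C₀ + 4 * (M * c ^ 2) + 12 * M, ?_, fun k => ?_, fun k => ?_, fun k x => ?_,
    fun k x s hs hsL => ?_⟩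
  · intro i j hij
    have : 0 ≤ C₀ + 4 * (M * c ^ 2) + 12 * M := by positivity
    dsimp only
    gcongr
  · linarith [hg k, hA k, hMc k, hMp k, hCp k, hMp2 k]
  · linarith [hτ k, hL k, hMc k, hMp k, hCp k, hMp2 k]
  · linarith [hrow k x, hMc k, hMp k, hCp k, hMp2 k]
  · have h1 := hrow (k + 1) x
    have h2 := hMc (k + 1)
    have h3 : M * (c ^ 2) ^ (k + 1) = M * c ^ 2 * (c ^ 2) ^ k := by ring
    have hs' : (0 : ℝ) ≤ s := by exact_mod_cast hs
    have hsL' : (s : ℝ) ≤ abutLen k := by exact_mod_cast hsL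
    have hsc : (s : ℝ) ≤ 3 * c ^ k := hsL'.trans (abutLen_le_pow hc k)
    have h4 : |(s : ℝ) * τ k| ≤ 3 * (M * (c ^ 2) ^ k) := by
      rw [abs_mul, abs_of_nonneg hs']
      calc (s : ℝ) * |τ k| ≤ 3 * c ^ k * (M * c ^ k) :=
            mul_le_mul hsc (hτ k) (abs_nonneg _) (by positivity)
        _ = _ := by ring
    have h5 : |w * (s * (abutLen k - s))| ≤ 9 * (M * (c ^ 2) ^ k) := by
      have h6 : 0 ≤ (s : ℝ) * (abutLen k - s) := mul_nonneg hs' (by linarith)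
      rw [abs_mul, abs_of_nonneg h6]
      calc |w| * (s * (abutLen k - s)) ≤ M * ((3 * c ^ k) * (3 * c ^ k)) := by
            refine mul_le_mul hw ?_ h6 hM
            exact mul_le_mul hsc (by linarith [abutLen_le_pow hc k]) (by linarith) (by positivity)
        _ = _ := by ring
    have h7 : abutPot β a K g A τ w k x s - a * x = (rowPot β a K g A τ (k + 1) x - a * x) +
        -(s * τ k) + -(w * (s * (abutLen k - s))) := by
      rw [abutPot]
      ring
    have h8 := abs_add_three (rowPot β a K g A τ (k + 1) x - a * x) (-(s * τ k))
      (-(w * (s * (abutLen k - s))))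
    rw [← h7, abs_neg, abs_neg] at h8
    linarith [hCp k]

lemma IsPotential.abs_glue_sub_pow_le {β c a D : ℝ} {B : ℕ → ℝ} {gr : ℕ → ℤ → ℝ}
    {ga : ℕ → ℤ → ℤ → ℝ} (hp : IsPotential β gr ga c B) (hcl : IsClose a gr ga B) (hD : 0 ≤ D)
    (hB : ∀ k, 1 ≤ k → B k ^ 4 ≤ D * bF (k - 1)) {x₀ : ℤ} {m : ℕ} {z : V}
    (hz : Reachable x₀ m z) : |glue gr ga z - a * z.1| ^ 4 ≤ D * (m + (x₀ + 4)) := by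
  obtain ⟨-, k, hk, hb, h⟩ := hz
  obtain ⟨x, y⟩ := z
  have hb' : (bF (k - 1) : ℝ) ≤ x₀ + m + 4 := by exact_mod_cast hb
  have key : |glue gr ga (x, y) - a * x| ≤ B k := by
    rcases h with h | ⟨hc, h1, h2, -⟩
    · rw [glue_row hk h]
      exact hcl.1 k x
    · dsimp only at hc h1 h2
      rw [glue_col hp hk hc h1.le h2.le]
      exact hcl.2 k x _ (abs_nonneg _) (abs_le.2 ⟨by omega, by omega⟩)
  calc |glue gr ga (x, y) - a * x| ^ 4 ≤ B k ^ 4 := by gcongr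
    _ ≤ D * bF (k - 1) := hB k hk
    _ ≤ D * (m + (x₀ + 4)) := by gcongr; linarith

lemma IsPotential.ae_eventually {β c a D : ℝ} (hβ : 1 < β) {B : ℕ → ℝ} {gr : ℕ → ℤ → ℝ}
    {ga : ℕ → ℤ → ℤ → ℝ} (hp : IsPotential β gr ga c B) (hcl : IsClose a gr ga B) (hD : 1 ≤ D)
    (hB : ∀ k, 1 ≤ k → B k ^ 4 ≤ D * bF (k - 1)) {z : V} (hz : IsRow 1 z)
    {μ : Measure (ℕ → V)} (hμ : IsWalkLaw β xiEdges z μ) {ε : ℝ} (hε : 0 < ε) (hε1 : ε ≤ 1) :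
    ∀ᵐ ω ∂μ, ∀ᶠ n : ℕ in atTop, (c - 3 * ε) * n ≤ a * (ω n).1 := by
  have hdrift := hp.hasDrift (by linarith) (x₀ := z.1) (by linarith) hB
  have hx₀ : 0 ≤ z.1 := hz.2.1
  have hx₀' : (0 : ℝ) ≤ z.1 := by exact_mod_cast hx₀
  have hstart : Reachable z.1 0 z := ⟨by simp, 1, le_rfl, by simp [bF, hx₀], Or.inl hz⟩
  have hreach : ∀ᵐ ω ∂μ, ∀ n, Reachable z.1 n (ω n) := by
    rw [ae_all_iff]
    intro n
    have h1 : ∀ᵐ ω ∂μ, ∀ w, ¬ Reachable z.1 n w → ω n ≠ w := by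
      rw [ae_all_iff]
      intro w
      by_cases hw : Reachable z.1 n w
      · exact Eventually.of_forall fun _ h => absurd hw h
      · have h2 := hdrift.ae_good hβ hμ hstart n w hw
        have h3 : ∀ᵐ ω ∂μ, ω n ≠ w := by
          rw [ae_iff]
          simpa using h2
        exact h3.mono fun _ h _ => h
    filter_upwards [h1] with ω hω
    by_contra h
    exact hω _ h rfl
  filter_upwards [hdrift.ae_eventually hβ hμ hstart hD (by linarith) hε hε1, hreach] with ω h1 h2
  filter_upwards [h1, eventually_ge_atTop ⌈(z.1 : ℝ) + 4⌉₊, eventually_ge_atTop ⌈2 * D / ε ^ 4⌉₊,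
    eventually_ge_atTop ⌈-glue gr ga z / ε⌉₊] with n h3 h4 h5 h6
  have h4 := Nat.ceil_le.1 h4
  have h5 := Nat.ceil_le.1 h5
  have h6 := Nat.ceil_le.1 h6
  rw [div_le_iff₀ (by positivity)] at h5 h6
  have hn : (1 : ℝ) ≤ n := by linarith
  have h7 : |glue gr ga (ω n) - a * (ω n).1| ≤ ε * n := by
    refine (pow_le_pow_iff_left₀ (abs_nonneg _) (by positivity) (by norm_num : 4 ≠ 0)).1 ?_
    calc _ ≤ D * (n + (z.1 + 4)) := hp.abs_glue_sub_pow_le hcl (by linarith) hB (h2 n)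
      _ ≤ D * (n + n) := by gcongr
      _ = 2 * D * n := by ring
      _ ≤ n * ε ^ 4 * n := by gcongr
      _ = ε ^ 4 * (n ^ 2 * 1) := by ring
      _ ≤ ε ^ 4 * (n ^ 2 * n ^ 2) := by
        gcongr
        exact one_le_pow₀ hn
      _ = _ := by ring
  have h8 := (abs_le.1 h7).2
  linarith

lemma ae_eventually_of_rowPot {β : ℝ} (hβ : 1 < β) {a c w M C : ℝ} {K : ℕ} {g A τ : ℕ → ℝ}
    (hC : 2 ≤ C) (hgM : ∀ k, |g k| ≤ M * C ^ k) (hAM : ∀ k, |A k| ≤ M * C ^ k)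
    (hτM : ∀ k, |τ k| ≤ M * C ^ k) (hwM : |w| ≤ M) (hg : ∀ k, K < k → g k = a)
    (htip : ∀ k, 1 ≤ k → ∀ e : ℝ, (1 - β⁻¹) * β⁻¹ - 1 / bF (k - 1) ≤ e → c ≤ g k + A k * e)
    (hplain : ∀ k, 1 ≤ k → c * (β + 1) ≤ (β - 1) * g k - A k * ((β - 1) / bF (k - 1)))
    (hroot : ∀ k, 1 ≤ k → c * (β + 3) ≤ (β - 1) * (g (k + 1) + A (k + 1) * (1 - 1 / bF k)) -
      2 * (τ k + w * (abutLen k - 1)))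
    (hcorner : ∀ k, 1 ≤ k → ∀ e ≤ 0, 2 * c ≤ -(g k + A k * e) + (τ k - w * (abutLen k - 1)))
    (hw : c ≤ w) {z : V} (hz : IsRow 1 z) {μ : Measure (ℕ → V)}
    (hμ : IsWalkLaw β xiEdges z μ) {ε : ℝ} (hε : 0 < ε) (hε1 : ε ≤ 1) :
    ∀ᵐ ω ∂μ, ∀ᶠ n : ℕ in atTop, (c - 3 * ε) * n ≤ a * (ω n).1 := by
  obtain ⟨N, hmono, h1, h2, hcl⟩ := exists_bound (a := a) (K := K) hβ hC hgM hAM hτM hwM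
  obtain ⟨D, hD, hB⟩ := exists_pow_four_le_bF N (C ^ 2)
  exact (isPotential_rowPot hβ hg hmono htip hplain hroot hcorner hw (fun k _ => h1 k)
    fun k _ => h2 k).ae_eventually hβ hcl hD hB hz hμ hε hε1

/-! ### The speed -/

lemma ae_eventually_ge {β : ℝ} (hβ : 1 < β) {z : V} (hz : IsRow 1 z) {μ : Measure (ℕ → V)}
    (hμ : IsWalkLaw β xiEdges z μ) {ε : ℝ} (hε : 0 < ε) (hε1 : ε ≤ 1) :
    ∀ᵐ ω ∂μ, ∀ᶠ n : ℕ in atTop, ((β - 1) / (β + 1) - ε - 3 * ε) * n ≤ 1 * ((ω n).1 : ℝ) := by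
  have hβ1 : 0 < β - 1 := by linarith
  have hβ2 : 0 < β + 1 := by linarith
  set v := (β - 1) / (β + 1) with hv
  have hv0 : 0 < v := div_pos hβ1 hβ2
  have hv1 : v ≤ 1 := by
    rw [hv, div_le_one hβ2]
    linarith
  have hvβ : v * (β + 1) = β - 1 := div_mul_cancel₀ _ hβ2.ne'
  have hv3 : v * (β + 3) ≤ 2 * (β - 1) := by nlinarith
  set C := 2 + 10 / (β - 1) with hC
  have hCβ : (β - 1) * C = 2 * (β - 1) + 10 := by
    rw [hC]
    field_simp
  have hC2 : 2 ≤ C := by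
    have : 0 < 10 / (β - 1) := by positivity
    linarith
  obtain ⟨K, hK⟩ := exists_forall_pow_le_bF (M := 2) (by norm_num) (by linarith : 1 < C) hε
  have hC1 : ∀ k : ℕ, 1 ≤ C ^ k := fun k => one_le_pow₀ (by linarith)
  set g : ℕ → ℝ := fun k => if k ≤ K then C ^ k else 1 with hg
  set A : ℕ → ℝ := fun k => if k ≤ K then 0 else 2 * C ^ k with hA
  have hglow : ∀ k, k ≤ K → g k = C ^ k ∧ A k = 0 := fun k hk => ⟨if_pos hk, if_pos hk⟩
  have hghigh : ∀ k, ¬ k ≤ K → g k = 1 ∧ A k = 2 * C ^ k := fun k hk => ⟨if_neg hk, if_neg hk⟩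
  have hg1 : ∀ k, 1 ≤ g k ∧ g k ≤ C ^ k := by
    intro k
    by_cases hk : k ≤ K
    · rw [(hglow k hk).1]
      exact ⟨hC1 k, le_rfl⟩
    · rw [(hghigh k hk).1]
      exact ⟨le_rfl, hC1 k⟩
  have hA0 : ∀ k, 0 ≤ A k ∧ A k ≤ 2 * C ^ k := by
    intro k
    by_cases hk : k ≤ K
    · rw [(hglow k hk).2]
      exact ⟨le_rfl, by linarith [hC1 k]⟩
    · rw [(hghigh k hk).2]
      exact ⟨by linarith [hC1 k], le_rfl⟩
  have hAb : ∀ k, A k / bF (k - 1) ≤ ε := by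
    intro k
    by_cases hk : k ≤ K
    · rw [(hglow k hk).2, zero_div]
      exact hε.le
    · rw [(hghigh k hk).2]
      exact hK k (by omega)
  have hL : ∀ k, (3 : ℝ) ≤ abutLen k ∧ (abutLen k : ℝ) ≤ 3 * C ^ k := fun k =>
    ⟨by exact_mod_cast three_le_abutLen k, abutLen_le_pow hC2 k⟩
  have hL2 : ∀ k, 1 ≤ k → 2 * (abutLen k : ℝ) ≤ 3 * C ^ k := by
    intro k hk
    rw [abutLen]
    push_cast
    have h1 : (2 : ℝ) * 2 ^ (k - 1) ≤ C ^ k := by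
      rw [← pow_succ', Nat.sub_add_cancel hk]
      gcongr
    linarith
  have hvL : ∀ k, 0 ≤ v * abutLen k ∧ v * abutLen k ≤ abutLen k := fun k =>
    ⟨mul_nonneg hv0.le (by linarith [hL k]), mul_le_of_le_one_left (by linarith [hL k]) hv1⟩
  refine ae_eventually_of_rowPot hβ (w := v) (M := 5) (C := C) (K := K) (g := g) (A := A)
    (τ := fun k => v * (abutLen k + 1) + g k) hC2 (fun k => ?_) (fun k => ?_) (fun k => ?_) ?_
    (fun k hk => (hghigh k (by omega)).1) (fun k hk e he => ?_) (fun k hk => ?_) (fun k hk => ?_)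
    (fun k hk e he => ?_) (by linarith) hz hμ hε hε1
  · rw [abs_of_nonneg (by linarith [hg1 k])]
    linarith [hg1 k]
  · rw [abs_of_nonneg (hA0 k).1]
    linarith [hA0 k, hC1 k]
  · rw [abs_of_nonneg (by linarith [hvL k, hg1 k])]
    linarith [hvL k, hg1 k, hL k, hC1 k]
  · rw [abs_of_nonneg hv0.le]
    linarith
  · have hinv : 0 ≤ (1 - β⁻¹) * β⁻¹ := mul_nonneg
      (sub_nonneg.2 (inv_le_one_of_one_le₀ hβ.le)) (inv_nonneg.2 (by linarith))
    have h1 : A k * (-(1 / bF (k - 1))) ≤ A k * e :=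
      mul_le_mul_of_nonneg_left (by linarith) (hA0 k).1
    have h2 := hAb k
    rw [div_eq_mul_one_div] at h2
    linarith [hg1 k]
  · have h1 : A k * ((β - 1) / bF (k - 1)) ≤ (β - 1) * ε := by
      calc A k * ((β - 1) / bF (k - 1)) = (β - 1) * (A k / bF (k - 1)) := by ring
        _ ≤ _ := by gcongr; exact hAb k
    have h2 : β - 1 ≤ (β - 1) * g k := le_mul_of_one_le_right hβ1.le (hg1 k).1
    linarith
  · have hb : (1 : ℝ) / bF k ≤ 1 / 4 := by
      have : (4 : ℝ) ≤ bF k := by exact_mod_cast four_le_bF k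
      gcongr
    have h1 : C * C ^ k ≤ g (k + 1) + A (k + 1) * (1 - 1 / bF k) := by
      rw [← pow_succ']
      by_cases hk' : k + 1 ≤ K
      · rw [(hglow _ hk').1, (hglow _ hk').2]
        linarith
      · rw [(hghigh _ hk').1, (hghigh _ hk').2]
        have : 0 ≤ 2 * C ^ (k + 1) * (1 / 4 - 1 / bF k) :=
          mul_nonneg (by linarith [hC1 (k + 1)]) (by linarith)
        linarith [hC1 (k + 1)]
    have h2 : (β - 1) * (C * C ^ k) = 2 * (β - 1) * C ^ k + 10 * C ^ k := by
      rw [← mul_assoc, hCβ]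
      ring
    have h3 : 2 * (β - 1) ≤ 2 * (β - 1) * C ^ k := le_mul_of_one_le_right (by linarith) (hC1 k)
    have h4 := mul_le_mul_of_nonneg_left h1 hβ1.le
    have h5 : 0 ≤ ε * (β + 3) := mul_nonneg hε.le (by linarith)
    linarith [hvL k, hL2 k hk, hg1 k]
  · have h1 := mul_nonneg (hA0 k).1 (neg_nonneg.2 he)
    linarith

lemma ae_eventually_le {β : ℝ} (hβ : 1 < β) {z : V} (hz : IsRow 1 z) {μ : Measure (ℕ → V)}
    (hμ : IsWalkLaw β xiEdges z μ) {ε : ℝ} (hε : 0 < ε) (hε1 : ε ≤ 1) :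
    ∀ᵐ ω ∂μ, ∀ᶠ n : ℕ in atTop, (-((β - 1) / (β + 1) + ε) - 3 * ε) * n ≤ -1 * ((ω n).1 : ℝ) := by
  have hβ1 : 0 < β - 1 := by linarith
  have hβ2 : 0 < β + 1 := by linarith
  set v := (β - 1) / (β + 1) with hv
  have hv0 : 0 < v := div_pos hβ1 hβ2
  have hv1 : v ≤ 1 := by
    rw [hv, div_le_one hβ2]
    linarith
  have hvβ : v * (β + 1) = β - 1 := div_mul_cancel₀ _ hβ2.ne'
  set D := β ^ 2 / (β - 1) with hD
  have hD0 : 0 ≤ D := by positivity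
  have hDβ : D * ((1 - β⁻¹) * β⁻¹) = 1 := by
    rw [hD]
    field_simp
  obtain ⟨K, hK⟩ := exists_forall_pow_le_bF (M := D) hD0 (by norm_num : (1 : ℝ) < 2) hε
  set g : ℕ → ℝ := fun k => if k ≤ K then -v else -1 with hg
  set A : ℕ → ℝ := fun k => if k ≤ K then 0 else D with hA
  have hcases : ∀ k, (g k = -v ∧ A k = 0) ∨ (g k = -1 ∧ A k = D ∧ D / bF (k - 1) ≤ ε) := by
    intro k
    by_cases hk : k ≤ K
    · exact Or.inl ⟨if_pos hk, if_pos hk⟩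
    · refine Or.inr ⟨if_neg hk, if_neg hk, le_trans ?_ (hK k (by omega))⟩
      gcongr
      exact le_mul_of_one_le_right hD0 (one_le_pow₀ (by norm_num))
  have h2 : ∀ k : ℕ, (1 : ℝ) ≤ 2 ^ k := fun k => one_le_pow₀ (by norm_num)
  have hD2 : ∀ k : ℕ, 1 + D ≤ (1 + D) * 2 ^ k := fun k =>
    le_mul_of_one_le_right (by linarith) (h2 k)
  refine ae_eventually_of_rowPot hβ (w := 0) (M := 1 + D) (C := 2) (K := K) (g := g) (A := A)
    (τ := fun _ => 0) le_rfl (fun k => ?_) (fun k => ?_) (fun k => ?_) ?_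
    (fun k hk => if_neg (by omega)) (fun k hk e he => ?_) (fun k hk => ?_) (fun k hk => ?_)
    (fun k hk e he => ?_) (by linarith) hz hμ hε hε1
  · rcases hcases k with ⟨h, -⟩ | ⟨h, -⟩ <;> rw [h, abs_neg]
    · rw [abs_of_pos hv0]
      linarith [hD2 k]
    · rw [abs_one]
      linarith [hD2 k]
  · rcases hcases k with ⟨-, h⟩ | ⟨-, h, -⟩ <;> rw [h]
    · rw [abs_zero]
      linarith [hD2 k]
    · rw [abs_of_nonneg hD0]
      linarith [hD2 k]
  · rw [abs_zero]
    linarith [hD2 k]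
  · rw [abs_zero]
    linarith
  · rcases hcases k with ⟨h3, h4⟩ | ⟨h3, h4, h5⟩ <;> rw [h3, h4]
    · linarith
    · have h6 := mul_le_mul_of_nonneg_left he hD0
      rw [mul_sub, hDβ, ← div_eq_mul_one_div] at h6
      linarith
  · rcases hcases k with ⟨h3, h4⟩ | ⟨h3, h4, h5⟩ <;> rw [h3, h4]
    · nlinarith
    · have h6 : D * ((β - 1) / bF (k - 1)) ≤ (β - 1) * ε := by
        calc D * ((β - 1) / bF (k - 1)) = (β - 1) * (D / bF (k - 1)) := by ring
          _ ≤ _ := by gcongr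
      linarith
  · have h6 : 0 ≤ ε * (β + 3) := mul_nonneg hε.le (by linarith)
    rcases hcases (k + 1) with ⟨h3, h4⟩ | ⟨h3, h4, -⟩ <;> rw [h3, h4]
    · nlinarith
    · have hb : (1 : ℝ) / bF k ≤ 1 := by
        have : (1 : ℝ) ≤ bF k := by exact_mod_cast (by linarith [four_le_bF k])
        exact (div_le_one (by linarith)).2 this
      have h7 : 0 ≤ (β - 1) * (D * (1 - 1 / bF k)) :=
        mul_nonneg hβ1.le (mul_nonneg hD0 (by linarith))
      linarith
  · rcases hcases k with ⟨h3, h4⟩ | ⟨h3, h4, -⟩ <;> rw [h3, h4]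
    · linarith
    · have := mul_nonneg hD0 (neg_nonneg.2 he)
      linarith

lemma OnMainPart.isRow {l x : ℤ} (hl : Odd l) (hx : IsTip 1 x) {z : V} (hz : OnMainPart 1 l x z) :
    IsRow 1 z := by
  obtain ⟨h1, h2, h3⟩ := hz
  obtain ⟨h4, h5⟩ := hx.rowOK le_rfl
  have hb := four_le_bF_int 1
  refine ⟨⟨l, hl, h1⟩, ?_⟩
  have h6 := h4.add h5 (z.1 - x).toNat (by omega)
  rwa [Int.toNat_of_nonneg (by omega), add_sub_cancel] at h6

/-- Proposition 4.2 (trap-free case). For every `β > 1`, the β-biased random walk started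
at a vertex on the main part of an order-1 branch of the fractal configuration ξ a.s. has
asymptotic speed `(β-1)/(β+1)`. -/
theorem speed_on_fractal (β : ℝ) (hβ : 1 < β) (l x : ℤ) (hl : Odd l) (hx : IsTip 1 x)
    (z : V) (hz : OnMainPart 1 l x z) (μ : Measure (ℕ → V))
    (hμ : IsWalkLaw β xiEdges z μ) :
    ∀ᵐ ω ∂μ, Tendsto (fun t : ℕ => ((ω t).1 : ℝ) / t) atTop
      (nhds ((β - 1) / (β + 1))) := by
  have hrow := hz.isRow hl hx
  have hpos (m : ℕ) : (0 : ℝ) < 1 / (m + 1) := by positivity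
  have hle (m : ℕ) : (1 : ℝ) / (m + 1) ≤ 1 :=
    (div_le_one (by positivity)).2 (by linarith [m.cast_nonneg (α := ℝ)])
  filter_upwards [ae_all_iff.2 fun m => ae_eventually_ge hβ hrow hμ (hpos m) (hle m),
    ae_all_iff.2 fun m => ae_eventually_le hβ hrow hμ (hpos m) (hle m)] with ω h₁ h₂
  rw [Metric.tendsto_atTop']
  intro δ hδ
  obtain ⟨m, hm⟩ := exists_nat_one_div_lt (show 0 < δ / 4 by positivity)
  obtain ⟨N, hN⟩ := eventually_atTop.1 ((h₁ m).and (h₂ m))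
  refine ⟨N, fun n hn => ?_⟩
  obtain ⟨h₃, h₄⟩ := hN n hn.le
  have hn0 : (0 : ℝ) < n := by exact_mod_cast (Nat.zero_le N).trans_lt hn
  rw [Real.dist_eq, abs_lt, lt_sub_iff_add_lt, sub_lt_iff_lt_add, lt_div_iff₀ hn0,
    div_lt_iff₀ hn0]
  have h₅ := mul_lt_mul_of_pos_right hm hn0
  constructor <;> nlinarith

end
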